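/- In U_q(gl_n) the following Newton identity holds: as formal power series in u⁻¹ with coefficients in U_q(gl_n), (1 + (1 − q⁻²) Σ_{m≥1} tr_q(L^m) u^{−m}) · E(u) = E(u q²), where E(u) = Σ_{m=0}^n (−u)^{−m} tr_{q(1,…,m)} L_{1̄} ⋯ L_{m̄} E_{(1^m)} (the m = 0 summand being 1) and E(u q²) is obtained from E(u) by substituting u q² for u. -/

import Mathlib

open scoped Classical

noncomputable section

namespace QImm

/-- `q` is not a root of unity. -/
def NotRootOfUnity (q : ℂ) : Prop := ∀ k : ℕ, 0 < k → q ^ k ≠ 1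

/-! ### The R-matrices -/

/-- The R-matrix `R = q ∑ eᵢᵢ⊗eᵢᵢ + ∑_{i≠j} eᵢᵢ⊗eⱼⱼ + (q-q⁻¹) ∑_{i<j} eᵢⱼ⊗eⱼᵢ`. -/
def Rmat (q : ℂ) (n : ℕ) : Matrix (Fin n × Fin n) (Fin n × Fin n) ℂ := fun p r =>
  if p.1 = r.1 ∧ p.2 = r.2 then (if p.1 = p.2 then q else 1)
  else if p.2 = r.1 ∧ p.1 = r.2 ∧ p.1 < r.1 then q - q⁻¹ else 0

/-- The permutation operator `P = ∑ eᵢⱼ⊗eⱼᵢ`. -/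
def Pmat (n : ℕ) : Matrix (Fin n × Fin n) (Fin n × Fin n) ℂ := fun p r =>
  if p.1 = r.2 ∧ p.2 = r.1 then 1 else 0

/-- `Ř = P R`. -/
def Rcheck (q : ℂ) (n : ℕ) : Matrix (Fin n × Fin n) (Fin n × Fin n) ℂ :=
  Pmat n * Rmat q n

/-! ### Embeddings into tensor legs: `(End ℂⁿ)^{⊗m} ⊗ A ≅ Matrix (Fin m → Fin n) (Fin m → Fin n) A` -/

/-- An `n×n` matrix over `A` placed in the `a`-th tensor leg (0-indexed) of
`(End ℂⁿ)^{⊗m} ⊗ A`. -/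
def leg1 {A : Type} [Ring A] (n m : ℕ) (X : Matrix (Fin n) (Fin n) A) (a : ℕ) :
    Matrix (Fin m → Fin n) (Fin m → Fin n) A := fun i j =>
  if h : a < m then
    if ∀ c : Fin m, (c : ℕ) ≠ a → i c = j c then X (i ⟨a, h⟩) (j ⟨a, h⟩) else 0
  else 0

/-- A scalar element of `End ℂⁿ ⊗ End ℂⁿ` placed in the `a`-th and `b`-th tensor legs
(0-indexed) of `(End ℂⁿ)^{⊗m} ⊗ A`. -/
def leg2 (A : Type) [Ring A] [Algebra ℂ A] (n m : ℕ)
    (C : Matrix (Fin n × Fin n) (Fin n × Fin n) ℂ) (a b : ℕ) :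
    Matrix (Fin m → Fin n) (Fin m → Fin n) A := fun i j =>
  if h : a < m ∧ b < m then
    if ∀ c : Fin m, (c : ℕ) ≠ a → (c : ℕ) ≠ b → i c = j c then
      algebraMap ℂ A (C (i ⟨a, h.1⟩, i ⟨b, h.2⟩) (j ⟨a, h.1⟩, j ⟨b, h.2⟩))
    else 0
  else 0

/-- `Ř_{k+1}` (paper numbering), acting in the tensor legs `k`, `k+1` (0-indexed). -/
def RcLeg (A : Type) [Ring A] [Algebra ℂ A] (q : ℂ) (n m : ℕ) (k : ℕ) :
    Matrix (Fin m → Fin n) (Fin m → Fin n) A :=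
  leg2 A n m (Rcheck q n) k (k + 1)

/-- `Ř⁻¹_{k+1}` (paper numbering), acting in the tensor legs `k`, `k+1` (0-indexed). -/
def RcLegInv (A : Type) [Ring A] [Algebra ℂ A] (q : ℂ) (n m : ℕ) (k : ℕ) :
    Matrix (Fin m → Fin n) (Fin m → Fin n) A :=
  leg2 A n m (Rcheck q n)⁻¹ k (k + 1)

/-- `legBar q n m X k` is `X_{\overline{k+1}}` (paper numbering), so `legBar q n m X 0 = X₁`
and `X_{\overline{k+1}} = Ř_k X_{\overline{k}} Ř_k⁻¹`. -/
def legBar {A : Type} [Ring A] [Algebra ℂ A] (q : ℂ) (n m : ℕ)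
    (X : Matrix (Fin n) (Fin n) A) : ℕ → Matrix (Fin m → Fin n) (Fin m → Fin n) A
  | 0 => leg1 n m X 0
  | k + 1 => RcLeg A q n m k * legBar q n m X k * RcLegInv A q n m k

/-! ### q-traces -/

/-- The q-trace over all `m` tensor legs: `tr_{q(1,…,m)} Y = tr D₁⋯D_m Y` with
`D = diag(1, q⁻², …, q^{-2n+2})`. -/
def qTr {A : Type} [Ring A] [Algebra ℂ A] (q : ℂ) (n m : ℕ)
    (Y : Matrix (Fin m → Fin n) (Fin m → Fin n) A) : A :=
  ∑ i : Fin m → Fin n,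
    algebraMap ℂ A (∏ a : Fin m, q ^ (-2 * ((i a : ℕ) : ℤ))) * Y i i

/-- The q-trace of a single `n×n` matrix: `tr_q X = tr D X`. -/
def qTr1 {A : Type} [Ring A] [Algebra ℂ A] (q : ℂ) (n : ℕ)
    (X : Matrix (Fin n) (Fin n) A) : A :=
  ∑ j : Fin n, algebraMap ℂ A (q ^ (-2 * ((j : ℕ) : ℤ))) * X j j

/-! ### The Hecke algebra -/

/-- The defining relations of the Hecke algebra `H_m` on generators `T_1, …, T_{m-1}`
(the generator `i : Fin (m-1)` is `T_{i+1}` in 1-indexed paper notation). -/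
inductive HeckeRel (q : ℂ) (m : ℕ) :
    FreeAlgebra ℂ (Fin (m - 1)) → FreeAlgebra ℂ (Fin (m - 1)) → Prop
  | quad (i : Fin (m - 1)) :
      HeckeRel q m
        ((FreeAlgebra.ι ℂ i - algebraMap ℂ (FreeAlgebra ℂ (Fin (m - 1))) q) *
          (FreeAlgebra.ι ℂ i + algebraMap ℂ (FreeAlgebra ℂ (Fin (m - 1))) q⁻¹)) 0
  | braid (i j : Fin (m - 1)) (h : (j : ℕ) = (i : ℕ) + 1) :
      HeckeRel q m (FreeAlgebra.ι ℂ i * FreeAlgebra.ι ℂ j * FreeAlgebra.ι ℂ i)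
        (FreeAlgebra.ι ℂ j * FreeAlgebra.ι ℂ i * FreeAlgebra.ι ℂ j)
  | commute (i j : Fin (m - 1)) (h : (i : ℕ) + 1 < (j : ℕ)) :
      HeckeRel q m (FreeAlgebra.ι ℂ i * FreeAlgebra.ι ℂ j)
        (FreeAlgebra.ι ℂ j * FreeAlgebra.ι ℂ i)

/-- The Hecke algebra `H_m`. -/
abbrev Hecke (q : ℂ) (m : ℕ) := RingQuot (HeckeRel q m)

/-- The generator `T_{i+1}` (paper 1-indexed) of `H_m`. -/
def Tgen (q : ℂ) (m : ℕ) (i : Fin (m - 1)) : Hecke q m :=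
  RingQuot.mkAlgHom ℂ (HeckeRel q m) (FreeAlgebra.ι ℂ i)

/-- `T_{k+1}` (paper 1-indexed), i.e. the 0-indexed `k`-th generator; junk value `1`
out of range. -/
def Tn (q : ℂ) (m : ℕ) (k : ℕ) : Hecke q m :=
  if h : k < m - 1 then Tgen q m ⟨k, h⟩ else 1

/-- The paper's 1-indexed generator `T_a`, `a = 1, …, m-1`. -/
def Tp (q : ℂ) (m : ℕ) (a : ℕ) : Hecke q m := Tn q m (a - 1)

/-- The Jucys–Murphy elements, 1-indexed: `y_1 = 1`, `y_{k+1} = T_k ⋯ T_2 T_1² T_2 ⋯ T_k`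
(the value at `0` is a junk value `1`). -/
def yJM (q : ℂ) (m : ℕ) : ℕ → Hecke q m
  | 0 => 1
  | 1 => 1
  | k + 2 => Tp q m (k + 1) * yJM q m (k + 1) * Tp q m (k + 1)

/-- The element `T_{(i,j)} = T_i T_{i+1} ⋯ T_{j-2} T_{j-1} T_{j-2} ⋯ T_{i+1} T_i` of `H_m`
associated with the transposition `(i,j)`, `1 ≤ i < j` (paper 1-indexed). -/
def Ttrans (q : ℂ) (m : ℕ) (i j : ℕ) : Hecke q m :=
  ((List.range' i (j - i)).map (Tp q m)).prod *
    (((List.range' i (j - 1 - i)).map (Tp q m)).reverse).prod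

/-- The condition that `φ : H_m → End((ℂⁿ)^{⊗m})` is the algebra homomorphism sending
`T_k ↦ Ř_k`. -/
def IsHeckeRep (q : ℂ) (n m : ℕ)
    (φ : Hecke q m →ₐ[ℂ] Matrix (Fin m → Fin n) (Fin m → Fin n) ℂ) : Prop :=
  ∀ k : ℕ, k < m - 1 → φ (Tn q m k) = RcLeg ℂ q n m k

/-! ### Young diagrams and standard tableaux -/

/-- The content `c(α) = j - i` of a box `α = (i, j)` (row `i`, column `j`, 0-indexed). -/
def ctn (α : ℕ × ℕ) : ℤ := (α.2 : ℤ) - (α.1 : ℤ)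

/-- A standard tableau of shape `μ` with `m` boxes, recorded via the position `pos k` of
each entry `k ∈ {1, …, m}`; entries strictly increase along rows and down columns. -/
structure StdTab (μ : YoungDiagram) (m : ℕ) where
  pos : ℕ → ℕ × ℕ
  bij : Set.BijOn pos (Set.Icc 1 m) (μ.cells : Set (ℕ × ℕ))
  row_lt : ∀ k ∈ Set.Icc 1 m, ∀ l ∈ Set.Icc 1 m,
    (pos k).1 = (pos l).1 → (pos k).2 < (pos l).2 → k < l
  col_lt : ∀ k ∈ Set.Icc 1 m, ∀ l ∈ Set.Icc 1 m,
    (pos k).2 = (pos l).2 → (pos k).1 < (pos l).1 → k < l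

/-- `c_k(U)`, the content of the box of `U` occupied by `k`. -/
def ctnAt {μ : YoungDiagram} {m : ℕ} (U : StdTab μ m) (k : ℕ) : ℤ := ctn (U.pos k)

/-- The condition singling out the primitive idempotent `e_U` of `H_m` associated with a
standard tableau `U`: a nonzero idempotent with `y_k e_U = e_U y_k = q^{2c_k(U)} e_U`. -/
def IsJMIdem (q : ℂ) (m : ℕ) {μ : YoungDiagram} (U : StdTab μ m) (e : Hecke q m) : Prop :=
  e ≠ 0 ∧ e * e = e ∧ ∀ k : ℕ, 1 ≤ k → k ≤ m →
    yJM q m k * e = (q ^ (2 * ctnAt U k) : ℂ) • e ∧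
    e * yJM q m k = (q ^ (2 * ctnAt U k) : ℂ) • e

/-! ### The quantized enveloping algebra `U_q(gl_n)` -/

/-- Generators: `inl (i,j) ↦ l⁺_{ij}`, `inr (i,j) ↦ l⁻_{ij}`. -/
abbrev UqGen (n : ℕ) := (Fin n × Fin n) ⊕ (Fin n × Fin n)

def lpF (n : ℕ) (i j : Fin n) : FreeAlgebra ℂ (UqGen n) := FreeAlgebra.ι ℂ (Sum.inl (i, j))
def lmF (n : ℕ) (i j : Fin n) : FreeAlgebra ℂ (UqGen n) := FreeAlgebra.ι ℂ (Sum.inr (i, j))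

/-- A matrix `X` over `F` placed in the first of two matrix legs of
`End ℂⁿ ⊗ End ℂⁿ ⊗ F`. -/
def M1 {F : Type} [Ring F] {n : ℕ} (X : Fin n → Fin n → F) :
    Matrix (Fin n × Fin n) (Fin n × Fin n) F := fun p r => if p.2 = r.2 then X p.1 r.1 else 0

/-- A matrix `X` over `F` placed in the second of two matrix legs of
`End ℂⁿ ⊗ End ℂⁿ ⊗ F`. -/
def M2 {F : Type} [Ring F] {n : ℕ} (X : Fin n → Fin n → F) :
    Matrix (Fin n × Fin n) (Fin n × Fin n) F := fun p r => if p.1 = r.1 then X p.2 r.2 else 0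

/-- The R-matrix, viewed over the free algebra on the generators of `U_q(gl_n)`. -/
def RmatU (q : ℂ) (n : ℕ) : Matrix (Fin n × Fin n) (Fin n × Fin n) (FreeAlgebra ℂ (UqGen n)) :=
  (Rmat q n).map (algebraMap ℂ (FreeAlgebra ℂ (UqGen n)))

/-- The defining relations of `U_q(gl_n)`. -/
inductive UqRel (q : ℂ) (n : ℕ) :
    FreeAlgebra ℂ (UqGen n) → FreeAlgebra ℂ (UqGen n) → Prop
  | upperZero (i j : Fin n) (h : j < i) : UqRel q n (lpF n i j) 0
  | lowerZero (i j : Fin n) (h : i < j) : UqRel q n (lmF n i j) 0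
  | diagPM (i : Fin n) : UqRel q n (lpF n i i * lmF n i i) 1
  | diagMP (i : Fin n) : UqRel q n (lmF n i i * lpF n i i) 1
  | rllPP (x y : Fin n × Fin n) :
      UqRel q n ((RmatU q n * M1 (lpF n) * M2 (lpF n)) x y)
        ((M2 (lpF n) * M1 (lpF n) * RmatU q n) x y)
  | rllMM (x y : Fin n × Fin n) :
      UqRel q n ((RmatU q n * M1 (lmF n) * M2 (lmF n)) x y)
        ((M2 (lmF n) * M1 (lmF n) * RmatU q n) x y)
  | rllPM (x y : Fin n × Fin n) :
      UqRel q n ((RmatU q n * M1 (lpF n) * M2 (lmF n)) x y)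
        ((M2 (lmF n) * M1 (lpF n) * RmatU q n) x y)

/-- The quantized enveloping algebra `U_q(gl_n)`. -/
abbrev Uq (q : ℂ) (n : ℕ) := RingQuot (UqRel q n)

def lp (q : ℂ) (n : ℕ) (i j : Fin n) : Uq q n := RingQuot.mkAlgHom ℂ (UqRel q n) (lpF n i j)
def lm (q : ℂ) (n : ℕ) (i j : Fin n) : Uq q n := RingQuot.mkAlgHom ℂ (UqRel q n) (lmF n i j)

/-- The matrix `L⁺`. -/
def Lp (q : ℂ) (n : ℕ) : Matrix (Fin n) (Fin n) (Uq q n) := Matrix.of fun i j => lp q n i j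
/-- The matrix `L⁻`. -/
def Lm (q : ℂ) (n : ℕ) : Matrix (Fin n) (Fin n) (Uq q n) := Matrix.of fun i j => lm q n i j

/-- `L = L⁺ (L⁻)⁻¹`, where `K` is the (two-sided) inverse of `L⁻`. -/
def Lmat (q : ℂ) (n : ℕ) (K : Matrix (Fin n) (Fin n) (Uq q n)) :
    Matrix (Fin n) (Fin n) (Uq q n) := Lp q n * K

/-! ### The braided Weyl algebra -/

/-- Generators: `inl (i,j) ↦ m_{ij}`, `inr (i,j) ↦ ∂_{ij}`. -/
abbrev WGen (n : ℕ) := (Fin n × Fin n) ⊕ (Fin n × Fin n)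

def mgF (n : ℕ) (i j : Fin n) : FreeAlgebra ℂ (WGen n) := FreeAlgebra.ι ℂ (Sum.inl (i, j))
def dgF (n : ℕ) (i j : Fin n) : FreeAlgebra ℂ (WGen n) := FreeAlgebra.ι ℂ (Sum.inr (i, j))

def RcW (q : ℂ) (n : ℕ) : Matrix (Fin n × Fin n) (Fin n × Fin n) (FreeAlgebra ℂ (WGen n)) :=
  (Rcheck q n).map (algebraMap ℂ (FreeAlgebra ℂ (WGen n)))

def RcWInv (q : ℂ) (n : ℕ) : Matrix (Fin n × Fin n) (Fin n × Fin n) (FreeAlgebra ℂ (WGen n)) :=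
  ((Rcheck q n)⁻¹).map (algebraMap ℂ (FreeAlgebra ℂ (WGen n)))

/-- The defining relations of the braided Weyl algebra `W_n`. -/
inductive WRel (q : ℂ) (n : ℕ) :
    FreeAlgebra ℂ (WGen n) → FreeAlgebra ℂ (WGen n) → Prop
  | mm (x y : Fin n × Fin n) :
      WRel q n ((RcW q n * M1 (mgF n) * RcW q n * M1 (mgF n)) x y)
        ((M1 (mgF n) * RcW q n * M1 (mgF n) * RcW q n) x y)
  | dd (x y : Fin n × Fin n) :
      WRel q n ((RcWInv q n * M1 (dgF n) * RcWInv q n * M1 (dgF n)) x y)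
        ((M1 (dgF n) * RcWInv q n * M1 (dgF n) * RcWInv q n) x y)
  | dm (x y : Fin n × Fin n) :
      WRel q n ((M1 (dgF n) * RcW q n * M1 (mgF n)) x y)
        ((RcW q n * M1 (mgF n) * RcWInv q n * M1 (dgF n) * RcWInv q n + 1) x y)

/-- The braided Weyl algebra `W_n`. -/
abbrev Weyl (q : ℂ) (n : ℕ) := RingQuot (WRel q n)

def mW (q : ℂ) (n : ℕ) (i j : Fin n) : Weyl q n := RingQuot.mkAlgHom ℂ (WRel q n) (mgF n i j)
def dW (q : ℂ) (n : ℕ) (i j : Fin n) : Weyl q n := RingQuot.mkAlgHom ℂ (WRel q n) (dgF n i j)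

/-- The matrix `M = [m_{ij}]` over `W_n`. -/
def Mmat (q : ℂ) (n : ℕ) : Matrix (Fin n) (Fin n) (Weyl q n) := Matrix.of fun i j => mW q n i j
/-- The matrix `𝒟 = [∂_{ij}]` over `W_n`. -/
def Dmat (q : ℂ) (n : ℕ) : Matrix (Fin n) (Fin n) (Weyl q n) := Matrix.of fun i j => dW q n i j

/-- The image `L = M𝒟 - (q - q⁻¹)⁻¹·1` of `L` in the braided Weyl algebra. -/
def LW (q : ℂ) (n : ℕ) : Matrix (Fin n) (Fin n) (Weyl q n) :=
  Mmat q n * Dmat q n - ((q - q⁻¹)⁻¹ : ℂ) • 1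

/-! ### The q-immanant polynomials -/

/-- The matrix `(L_{1̄} + z q^{-2c₁(U)}) ⋯ (L_{m̄} + z q^{-2c_m(U)}) E_U`, where `E` is the
image `E_U` of the primitive idempotent `e_U`. -/
def prodU {A : Type} [Ring A] [Algebra ℂ A] (q : ℂ) (n m : ℕ) {μ : YoungDiagram}
    (U : StdTab μ m) (E : Matrix (Fin m → Fin n) (Fin m → Fin n) ℂ)
    (X : Matrix (Fin n) (Fin n) A) (z : ℂ) :
    Matrix (Fin m → Fin n) (Fin m → Fin n) A :=
  (((List.range m).map fun k =>
      legBar q n m X k + ((z * q ^ (-2 * ctnAt U (k + 1))) : ℂ) • 1)).prod *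
    E.map (algebraMap ℂ A)

/-- The q-immanant polynomial
`S_U(z) = tr_{q(1,…,m)} (L_{1̄} + z q^{-2c₁(U)}) ⋯ (L_{m̄} + z q^{-2c_m(U)}) E_U`. -/
def SUpoly {A : Type} [Ring A] [Algebra ℂ A] (q : ℂ) (n m : ℕ) {μ : YoungDiagram}
    (U : StdTab μ m) (E : Matrix (Fin m → Fin n) (Fin m → Fin n) ℂ)
    (X : Matrix (Fin n) (Fin n) A) (z : ℂ) : A :=
  qTr q n m (prodU q n m U E X z)

/-- The coefficient `a_μ = ∏_{α ∈ μ} q^{-2c(α)}`. -/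
def aCoeff (q : ℂ) (μ : YoungDiagram) : ℂ := ∏ α ∈ μ.cells, q ^ (-2 * ctn α)

/-- `tr_{q(1,…,m)} L_{1̄} ⋯ L_{m̄} E_{(1^m)}`, where `Em` is the image of the primitive
idempotent associated with the column diagram `(1^m)`. -/
def colElem (q : ℂ) (n k : ℕ) (K : Matrix (Fin n) (Fin n) (Uq q n))
    (φk : Hecke q k →ₐ[ℂ] Matrix (Fin k → Fin n) (Fin k → Fin n) ℂ)
    (ek : Hecke q k) : Uq q n :=
  qTr q n k (((List.range k).map fun j => legBar q n k (Lmat q n K) j).prod *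
    (φk ek).map (algebraMap ℂ (Uq q n)))

/-- The semistandardness condition on a filling of the boxes of `μ` with entries in
`{1, …, n}` (encoded as `Fin n`): weakly increasing along rows, strictly increasing
down columns. -/
def SSYTCond {n : ℕ} (μ : YoungDiagram) (f : {x // x ∈ μ.cells} → Fin n) : Prop :=
  (∀ a b : {x // x ∈ μ.cells}, (a : ℕ × ℕ).1 = (b : ℕ × ℕ).1 →
    (a : ℕ × ℕ).2 ≤ (b : ℕ × ℕ).2 → f a ≤ f b) ∧
  (∀ a b : {x // x ∈ μ.cells}, (a : ℕ × ℕ).2 = (b : ℕ × ℕ).2 →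
    (a : ℕ × ℕ).1 < (b : ℕ × ℕ).1 → f a < f b)

/-- The factorial Schur polynomial `s_μ(x₁,…,x_n | a)` evaluated at `x_i = q^{2ℓ_i}`,
`ℓ_i = λ_i - i + 1` (1-indexed), with parameter sequence `a_j = z q^{1-2j}`. -/
def factSchur {n : ℕ} (q z : ℂ) (lam : Fin n → ℤ) (μ : YoungDiagram) : ℂ :=
  ∑ f : {x // x ∈ μ.cells} → Fin n,
    if SSYTCond μ f then
      ∏ α : {x // x ∈ μ.cells},
        (q ^ (2 * (lam (f α) - ((f α : ℕ) : ℤ))) +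
          z * q ^ (1 - 2 * (((f α : ℕ) : ℤ) + 1 + ctn (α : ℕ × ℕ))))
    else 0

/-! ### Generators and relations of the Hecke algebra -/

theorem hecke_induction {q : ℂ} {m : ℕ} {motive : Hecke q m → Prop}
    (algebraMap : ∀ c : ℂ, motive (algebraMap ℂ _ c))
    (gen : ∀ k, k < m - 1 → motive (Tn q m k))
    (mul : ∀ x y, motive x → motive y → motive (x * y))
    (add : ∀ x y, motive x → motive y → motive (x + y)) (x : Hecke q m) : motive x := by
  obtain ⟨x, rfl⟩ := RingQuot.mkAlgHom_surjective ℂ (HeckeRel q m) x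
  induction x using FreeAlgebra.induction with
  | grade0 c => simpa using algebraMap c
  | grade1 i => simpa [Tn, Tgen] using gen i i.2
  | mul a b ha hb => simpa using mul _ _ ha hb
  | add a b ha hb => simpa using add _ _ ha hb

theorem quad_iff {M : Type*} [Ring M] [Algebra ℂ M] {q : ℂ} (hq : q ≠ 0) (t : M) :
    (t - algebraMap ℂ M q) * (t + algebraMap ℂ M q⁻¹) = 0 ↔ t * t = (q - q⁻¹) • t + 1 := by
  have : (t - algebraMap ℂ M q) * (t + algebraMap ℂ M q⁻¹) = t * t - ((q - q⁻¹) • t + 1) := by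
    have h1 : algebraMap ℂ M q * algebraMap ℂ M q⁻¹ = 1 := by
      rw [← map_mul, mul_inv_cancel₀ hq, map_one]
    rw [sub_mul, mul_add, mul_add, h1, ← Algebra.commutes q⁻¹ t, ← Algebra.smul_def,
      ← Algebra.smul_def, sub_smul]
    abel
  rw [this, sub_eq_zero]

theorem Tn_quad {q : ℂ} (hq : q ≠ 0) {m k : ℕ} (hk : k < m - 1) :
    Tn q m k * Tn q m k = (q - q⁻¹) • Tn q m k + 1 := by
  rw [← quad_iff hq]
  have := RingQuot.mkAlgHom_rel ℂ (HeckeRel.quad (q := q) (m := m) ⟨k, hk⟩)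
  simpa [Tn, hk, Tgen] using this

theorem Tn_braid (q : ℂ) {m k : ℕ} (hk : k + 1 < m - 1) :
    Tn q m k * Tn q m (k + 1) * Tn q m k = Tn q m (k + 1) * Tn q m k * Tn q m (k + 1) := by
  have := RingQuot.mkAlgHom_rel ℂ
    (HeckeRel.braid (q := q) (m := m) ⟨k, by omega⟩ ⟨k + 1, hk⟩ rfl)
  simpa [Tn, hk, Tgen, show k < m - 1 by omega] using this

theorem Tn_comm (q : ℂ) (m : ℕ) {k l : ℕ} (h : k + 1 < l) : Commute (Tn q m k) (Tn q m l) := by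
  by_cases hl : l < m - 1
  · have := RingQuot.mkAlgHom_rel ℂ
      (HeckeRel.commute (q := q) (m := m) ⟨k, by omega⟩ ⟨l, hl⟩ h)
    rw [commute_iff_eq]
    simpa [Tn, hl, Tgen, show k < m - 1 by omega] using this
  · simp [Tn, hl]

/-- The homomorphism out of the Hecke algebra determined by the images of the generators. -/
def heckeLift {M : Type*} [Ring M] [Algebra ℂ M] {q : ℂ} (hq : q ≠ 0) (m : ℕ) (t : ℕ → M)
    (quad : ∀ k < m - 1, t k * t k = (q - q⁻¹) • t k + 1)
    (braid : ∀ k, k + 1 < m - 1 → t k * t (k + 1) * t k = t (k + 1) * t k * t (k + 1))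
    (comm : ∀ k l, k + 1 < l → l < m - 1 → t k * t l = t l * t k) : Hecke q m →ₐ[ℂ] M :=
  RingQuot.liftAlgHom ℂ ⟨FreeAlgebra.lift ℂ fun i : Fin (m - 1) => t i, by
    intro x y h
    cases h with
    | quad i => simpa using (quad_iff hq _).2 (quad i i.2)
    | braid i j h =>
      have := braid i (by omega)
      simpa [h] using this
    | commute i j h => simpa using comm i j h j.2⟩

theorem heckeLift_Tn {M : Type*} [Ring M] [Algebra ℂ M] {q : ℂ} (hq : q ≠ 0) (m : ℕ) (t : ℕ → M)
    (quad) (braid) (comm) {k : ℕ} (hk : k < m - 1) :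
    heckeLift hq m t quad braid comm (Tn q m k) = t k := by
  simp [heckeLift, Tn, hk, Tgen]

/-- The one-dimensional representation `T_k ↦ -q⁻¹`. -/
def sgn {q : ℂ} (hq : q ≠ 0) (m : ℕ) : Hecke q m →ₐ[ℂ] ℂ :=
  heckeLift hq m (fun _ => -q⁻¹) (fun _ _ => by simp; field_simp; ring) (fun _ _ => rfl)
    (fun _ _ _ _ => rfl)

/-- The embedding `H_m → H_{m+1}`, `T_k ↦ T_k`. -/
def incl {q : ℂ} (hq : q ≠ 0) (m : ℕ) : Hecke q m →ₐ[ℂ] Hecke q (m + 1) :=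
  heckeLift hq m (Tn q (m + 1)) (fun _ _ => Tn_quad hq (by omega))
    (fun _ _ => Tn_braid q (by omega)) (fun _ _ h _ => Tn_comm q _ h)

/-- The embedding `H_m → H_{m+1}`, `T_k ↦ T_{k+1}`. -/
def shift {q : ℂ} (hq : q ≠ 0) (m : ℕ) : Hecke q m →ₐ[ℂ] Hecke q (m + 1) :=
  heckeLift hq m (fun k => Tn q (m + 1) (k + 1)) (fun _ _ => Tn_quad hq (by omega))
    (fun _ _ => Tn_braid q (by omega)) (fun _ _ h _ => Tn_comm q _ (by omega))

theorem sgn_Tn {q : ℂ} (hq : q ≠ 0) {m k : ℕ} (hk : k < m - 1) : sgn hq m (Tn q m k) = -q⁻¹ :=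
  heckeLift_Tn hq m _ _ _ _ hk

theorem incl_Tn {q : ℂ} (hq : q ≠ 0) {m k : ℕ} (hk : k < m - 1) :
    incl hq m (Tn q m k) = Tn q (m + 1) k :=
  heckeLift_Tn hq m _ _ _ _ hk

theorem shift_Tn {q : ℂ} (hq : q ≠ 0) {m k : ℕ} (hk : k < m - 1) :
    shift hq m (Tn q m k) = Tn q (m + 1) (k + 1) :=
  heckeLift_Tn hq m _ _ _ _ hk

theorem sgn_shift {q : ℂ} (hq : q ≠ 0) (m : ℕ) (x : Hecke q m) :
    sgn hq (m + 1) (shift hq m x) = sgn hq m x := by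
  induction x using hecke_induction with
  | algebraMap c => simp
  | gen k hk => rw [shift_Tn hq hk, sgn_Tn hq hk, sgn_Tn hq (by omega)]
  | mul x y hx hy => simp [hx, hy]
  | add x y hx hy => simp [hx, hy]

/-! ### Sign idempotents and Jucys–Murphy elements -/

theorem NotRootOfUnity.inv_pow_ne {q : ℂ} (h : NotRootOfUnity q) (hq : q ≠ 0) {a b : ℕ}
    (hab : a < b) : q⁻¹ ^ a ≠ q⁻¹ ^ b := by
  intro he
  apply h (b - a) (by omega)
  have hb : b = a + (b - a) := by omega
  rw [hb, pow_add] at he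
  have : q⁻¹ ^ a ≠ 0 := pow_ne_zero _ (inv_ne_zero hq)
  have h1 : q⁻¹ ^ (b - a) = 1 := by
    apply mul_left_cancel₀ this
    rw [← he, mul_one]
  rwa [inv_pow, inv_eq_one] at h1

/-- No simultaneous eigenvector of the Jucys–Murphy elements has contents
`0, -1, …, -(i-1), -c` with `c > i`. -/
theorem jucysMurphy_eigenvector_eq_zero {M : Type*} [Ring M] [Algebra ℂ M] {q : ℂ} (hq : q ≠ 0)
    (hq' : NotRootOfUnity q) (t z : ℕ → M) (z0 : z 0 = 1) (zs : ∀ k, z (k + 1) = t k * z k * t k)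
    (N : ℕ) (quad : ∀ k < N, t k * t k = (q - q⁻¹) • t k + 1)
    (comm : ∀ j k, j < k → Commute (t k) (z j)) :
    ∀ i ≤ N, ∀ (v : M) (c : ℕ), i < c → (∀ j < i, z j * v = (q⁻¹ ^ (2 * j)) • v) →
      z i * v = (q⁻¹ ^ (2 * c)) • v → v = 0 := by
  intro i
  induction i with
  | zero =>
    intro _ v c hc _ h
    rw [z0, one_mul] at h
    have h2 : (1 - q⁻¹ ^ (2 * c)) • v = 0 := by rw [sub_smul, one_smul, ← h, sub_self]
    refine (smul_eq_zero.1 h2).resolve_left (sub_ne_zero.2 ?_)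
    simpa using hq'.inv_pow_ne hq (show 0 < 2 * c by omega)
  | succ i ih =>
    intro hi v c hc hlow h
    set a : ℂ := q⁻¹ ^ (2 * i) with ha
    set b : ℂ := q⁻¹ ^ (2 * c) with hb
    set s : ℂ := q - q⁻¹ with hs
    have hab : b - a ≠ 0 := sub_ne_zero.2 (hq'.inv_pow_ne hq (show 2 * i < 2 * c by omega)).symm
    have hb0 : b ≠ 0 := pow_ne_zero _ (inv_ne_zero hq)
    have hT := quad i (by omega)
    have hTT : (t i - s • 1) * t i = 1 := by rw [sub_mul, hT]; simp
    have hza : z i * v = a • v := hlow i (by omega)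
    have hzt : z i * (t i * v) = b • (t i * v) - (b * s) • v := by
      calc z i * (t i * v) = ((t i - s • 1) * t i) * (z i * (t i * v)) := by rw [hTT, one_mul]
        _ = (t i - s • 1) * (z (i + 1) * v) := by rw [zs]; simp only [mul_assoc]
        _ = _ := by
          rw [h, sub_mul, mul_smul_comm, mul_smul_comm, smul_mul_assoc, one_mul, smul_smul]
    have hw : t i * v - (s * b / (b - a)) • v = 0 := by
      apply ih (by omega) _ c (by omega)
      · intro j hj
        rw [mul_sub, ← mul_assoc, ← (comm j i hj).eq, mul_assoc, mul_smul_comm,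
          hlow j (by omega), mul_smul_comm, smul_sub, smul_comm]
      · rw [mul_sub, hzt, mul_smul_comm, hza, smul_sub, smul_smul, smul_smul, sub_sub, ← add_smul]
        congr 2
        rw [← hb]; field_simp; ring
    have hw' : t i * v = (s * b / (b - a)) • v := sub_eq_zero.1 hw
    have h3 : ((s * b / (b - a)) * (s * b / (b - a)) - (s * (s * b / (b - a)) + 1)) • v = 0 := by
      have := congrArg (· * v) hT
      simp only [mul_assoc, add_mul, one_mul, smul_mul_assoc, hw', mul_smul_comm, smul_smul] at this
      rw [sub_smul, add_smul, one_smul, this, sub_self]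
    refine (smul_eq_zero.1 h3).resolve_left fun h4 => ?_
    have h5 : (b - q⁻¹ ^ 2 * a) * (b - q ^ 2 * a) = 0 := by
      rw [hs] at h4
      field_simp at h4 ⊢
      linear_combination (-1 : ℂ) * h4
    rcases mul_eq_zero.1 h5 with h6 | h6
    · rw [ha, ← pow_add] at h6
      exact hq'.inv_pow_ne hq (show 2 + 2 * i < 2 * c by omega) (sub_eq_zero.1 h6).symm
    · have h7 : q⁻¹ ^ 2 * b = a := by
        rw [sub_eq_zero.1 h6]; field_simp
      rw [ha, hb, ← pow_add] at h7
      exact hq'.inv_pow_ne hq (show 2 * i < 2 + 2 * c by omega) h7.symm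

theorem generator_mul_of_jucysMurphy {M : Type*} [Ring M] [Algebra ℂ M] {q : ℂ} (hq : q ≠ 0)
    (hq' : NotRootOfUnity q) (t z : ℕ → M) (z0 : z 0 = 1) (zs : ∀ k, z (k + 1) = t k * z k * t k)
    (N : ℕ) (quad : ∀ k < N, t k * t k = (q - q⁻¹) • t k + 1)
    (comm : ∀ j k, j < k → Commute (t k) (z j)) (e : M)
    (he : ∀ j ≤ N, z j * e = (q⁻¹ ^ (2 * j)) • e) {k : ℕ} (hk : k < N) :
    t k * e = (-q⁻¹) • e := by
  have hT := quad k hk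
  set s : ℂ := q - q⁻¹ with hs
  have hTT : (t k - s • 1) * t k = 1 := by rw [sub_mul, hT]; simp
  have hzt : z k * (t k * e) = (q⁻¹ ^ (2 * (k + 1))) • (t k * e - s • e) := by
    calc z k * (t k * e) = ((t k - s • 1) * t k) * (z k * (t k * e)) := by rw [hTT, one_mul]
      _ = (t k - s • 1) * (z (k + 1) * e) := by rw [zs]; simp only [mul_assoc]
      _ = _ := by
        rw [he (k + 1) hk, sub_mul, mul_smul_comm, mul_smul_comm, smul_mul_assoc, one_mul,
          smul_sub]
  have hv : t k * e + q⁻¹ • e = 0 := by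
    apply jucysMurphy_eigenvector_eq_zero hq hq' t z z0 zs N quad comm k hk.le _ (k + 1)
      (by omega)
    · intro j hj
      rw [mul_add, ← mul_assoc, ← (comm j k hj).eq, mul_assoc, mul_smul_comm,
        he j (by omega), mul_smul_comm, smul_add, smul_comm]
    · rw [mul_add, hzt, mul_smul_comm, he k hk.le, smul_sub, smul_add, smul_smul, smul_smul,
        smul_smul, sub_add, ← sub_smul, sub_eq_add_neg, ← neg_smul]
      congr 2
      have hqi : q * q⁻¹ = 1 := mul_inv_cancel₀ hq
      rw [hs]
      linear_combination (-(q⁻¹ ^ (2 * k) * q⁻¹)) * hqi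
  rw [neg_smul]
  exact eq_neg_of_add_eq_zero_left hv

/-- An idempotent on which all generators of the Hecke algebra act by `-q⁻¹` from both sides. -/
structure IsSignIdem {q : ℂ} {m : ℕ} (e : Hecke q m) : Prop where
  ne_zero : e ≠ 0
  idem : e * e = e
  gen_mul : ∀ k < m - 1, Tn q m k * e = (-q⁻¹) • e
  mul_gen : ∀ k < m - 1, e * Tn q m k = (-q⁻¹) • e

theorem commute_Tn_yJM (q : ℂ) (m : ℕ) {j k : ℕ} (h : j < k) :
    Commute (Tn q m k) (yJM q m (j + 1)) := by
  induction j with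
  | zero => exact Commute.one_right _
  | succ j ih =>
    have h1 : Commute (Tn q m k) (Tn q m j) := (Tn_comm q m (by omega)).symm
    exact (h1.mul_right (ih (by omega))).mul_right h1

theorem isSignIdem_of_jucysMurphy {q : ℂ} (hq : q ≠ 0) (hq' : NotRootOfUnity q) {m : ℕ}
    (e : Hecke q m)
    (he : e ≠ 0 ∧ e * e = e ∧ ∀ k : ℕ, 1 ≤ k → k ≤ m →
      yJM q m k * e = (q ^ (-2 * ((k : ℤ) - 1)) : ℂ) • e ∧
      e * yJM q m k = (q ^ (-2 * ((k : ℤ) - 1)) : ℂ) • e) : IsSignIdem e := by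
  obtain ⟨h0, h1, h2⟩ := he
  have hpow : ∀ j : ℕ, q ^ (-2 * (((j + 1 : ℕ) : ℤ) - 1)) = q⁻¹ ^ (2 * j) := by
    intro j
    rw [inv_pow, ← zpow_natCast, ← zpow_neg]
    congr 1
    push_cast
    ring
  refine ⟨h0, h1, fun k hk => ?_, fun k hk => ?_⟩
  · refine generator_mul_of_jucysMurphy hq hq' (Tn q m) (fun j => yJM q m (j + 1)) rfl
      (fun _ => rfl) (m - 1) (fun _ => Tn_quad hq) (fun _ _ => commute_Tn_yJM q m) e ?_ hk
    intro j hj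
    rw [(h2 (j + 1) (by omega) (by omega)).1, hpow]
  · have := generator_mul_of_jucysMurphy (M := (Hecke q m)ᵐᵒᵖ) hq hq'
      (fun k => MulOpposite.op (Tn q m k)) (fun j => MulOpposite.op (yJM q m (j + 1))) rfl
      (fun k => by
        change MulOpposite.op (Tn q m k * yJM q m (k + 1) * Tn q m k) = _
        simp [mul_assoc]) (m - 1)
      (fun k hk => by
        rw [← MulOpposite.op_mul, Tn_quad hq hk]; simp)
      (fun _ _ h => (commute_Tn_yJM q m h).op) (MulOpposite.op e)
      (fun j hj => by
        rw [← MulOpposite.op_mul, (h2 (j + 1) (by omega) (by omega)).2, hpow]; simp) hk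
    rw [← MulOpposite.op_mul, ← MulOpposite.op_smul] at this
    exact MulOpposite.op_injective this

theorem mul_eq_sgn_smul {q : ℂ} (hq : q ≠ 0) {m : ℕ} {a : Hecke q m}
    (ha : ∀ k < m - 1, a * Tn q m k = (-q⁻¹) • a) (x : Hecke q m) : a * x = sgn hq m x • a := by
  induction x using hecke_induction with
  | algebraMap c => rw [← Algebra.commutes, ← Algebra.smul_def]; simp
  | gen k hk => rw [sgn_Tn hq hk, ha k hk]
  | mul x y hx hy => rw [← mul_assoc, hx, smul_mul_assoc, hy, smul_smul, map_mul]
  | add x y hx hy => rw [mul_add, hx, hy, map_add, add_smul]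

theorem eq_sgn_smul_mul {q : ℂ} (hq : q ≠ 0) {m : ℕ} {a : Hecke q m}
    (ha : ∀ k < m - 1, Tn q m k * a = (-q⁻¹) • a) (x : Hecke q m) : x * a = sgn hq m x • a := by
  induction x using hecke_induction with
  | algebraMap c => rw [← Algebra.smul_def]; simp
  | gen k hk => rw [sgn_Tn hq hk, ha k hk]
  | mul x y hx hy => rw [mul_assoc, hy, mul_smul_comm, hx, smul_smul, map_mul, mul_comm]
  | add x y hx hy => rw [add_mul, hx, hy, map_add, add_smul]

theorem IsSignIdem.sgn_eq_one {q : ℂ} (hq : q ≠ 0) {m : ℕ} {e : Hecke q m} (he : IsSignIdem e) :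
    sgn hq m e = 1 := by
  have h := eq_sgn_smul_mul hq he.gen_mul e
  rw [he.idem] at h
  have h2 : sgn hq m e = sgn hq m e * sgn hq m e := by rw [← map_mul, he.idem]
  rcases eq_or_ne (sgn hq m e) 0 with h0 | h0
  · rw [h0, zero_smul] at h
    exact absurd h he.ne_zero
  · exact (mul_left_cancel₀ h0 (by rw [mul_one, ← h2])).symm

theorem IsSignIdem.eq_one {q : ℂ} (hq : q ≠ 0) {m : ℕ} (hm : m ≤ 1) {e : Hecke q m}
    (he : IsSignIdem e) : e = 1 := by
  have h := mul_eq_sgn_smul hq (a := (1 : Hecke q m)) (fun k hk => by omega) e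
  rwa [he.sgn_eq_one hq, one_mul, one_smul] at h

/-! ### The recursion for sign idempotents -/

/-- The product `T_1 T_2 ⋯ T_j`. -/
def Tasc (q : ℂ) (m : ℕ) : ℕ → Hecke q m
  | 0 => 1
  | j + 1 => Tasc q m j * Tn q m j

/-- The product `T_j⁻¹ ⋯ T_2⁻¹ T_1⁻¹`. -/
def TascInv (q : ℂ) (m : ℕ) : ℕ → Hecke q m
  | 0 => 1
  | j + 1 => (Tn q m j - (q - q⁻¹) • 1) * TascInv q m j

theorem Tn_mul_inv {q : ℂ} (hq : q ≠ 0) {m k : ℕ} (hk : k < m - 1) :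
    Tn q m k * (Tn q m k - (q - q⁻¹) • 1) = 1 := by
  rw [mul_sub, Tn_quad hq hk]; simp

theorem Tn_inv_mul {q : ℂ} (hq : q ≠ 0) {m k : ℕ} (hk : k < m - 1) :
    (Tn q m k - (q - q⁻¹) • 1) * Tn q m k = 1 := by
  rw [sub_mul, Tn_quad hq hk]; simp

theorem Tasc_mul_inv {q : ℂ} (hq : q ≠ 0) {m j : ℕ} (hj : j ≤ m - 1) :
    Tasc q m j * TascInv q m j = 1 := by
  induction j with
  | zero => simp [Tasc, TascInv]
  | succ j ih =>
    rw [Tasc, TascInv, mul_assoc, ← mul_assoc (Tn q m j), Tn_mul_inv hq (by omega), one_mul,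
      ih (by omega)]

theorem TascInv_mul {q : ℂ} (hq : q ≠ 0) {m j : ℕ} (hj : j ≤ m - 1) :
    TascInv q m j * Tasc q m j = 1 := by
  induction j with
  | zero => simp [Tasc, TascInv]
  | succ j ih =>
    rw [Tasc, TascInv, mul_assoc, ← mul_assoc (TascInv q m j), ih (by omega), one_mul,
      Tn_inv_mul hq (by omega)]

theorem commute_Tasc_Tn (q : ℂ) (m : ℕ) {j k : ℕ} (h : j < k) :
    Commute (Tasc q m j) (Tn q m k) := by
  induction j with
  | zero => exact Commute.one_left _
  | succ j ih => exact (ih (by omega)).mul_left (Tn_comm q m h)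

theorem Tasc_mul_Tn (q : ℂ) {m j k : ℕ} (hk : k + 1 < j) (hj : j ≤ m - 1) :
    Tasc q m j * Tn q m k = Tn q m (k + 1) * Tasc q m j := by
  induction j with
  | zero => omega
  | succ j ih =>
    rcases Nat.lt_or_ge (k + 1) j with h | h
    · rw [Tasc, mul_assoc, ← (Tn_comm q m h).eq, ← mul_assoc, ih h (by omega), mul_assoc]
    · obtain rfl : j = k + 1 := by omega
      rw [Tasc, Tasc, mul_assoc, mul_assoc, ← mul_assoc (Tn q m k), Tn_braid q (by omega),
        ← mul_assoc, ← mul_assoc, (commute_Tasc_Tn q m (Nat.lt_succ_self k)).eq]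
      simp only [mul_assoc]

theorem incl_Tasc {q : ℂ} (hq : q ≠ 0) {m j : ℕ} (hj : j ≤ m - 1) :
    incl hq m (Tasc q m j) = Tasc q (m + 1) j := by
  induction j with
  | zero => simp [Tasc]
  | succ j ih => rw [Tasc, Tasc, map_mul, ih (by omega), incl_Tn hq (by omega)]

theorem incl_TascInv {q : ℂ} (hq : q ≠ 0) {m j : ℕ} (hj : j ≤ m - 1) :
    incl hq m (TascInv q m j) = TascInv q (m + 1) j := by
  induction j with
  | zero => simp [TascInv]
  | succ j ih =>
    rw [TascInv, TascInv, map_mul, ih (by omega), map_sub, incl_Tn hq (by omega), map_smul,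
      map_one]

theorem Tn_mul_shift_Tasc {q : ℂ} (hq : q ≠ 0) {m j : ℕ} (hj : j ≤ m - 1) :
    Tn q (m + 1) 0 * shift hq m (Tasc q m j) = Tasc q (m + 1) (j + 1) := by
  induction j with
  | zero => simp [Tasc]
  | succ j ih =>
    rw [Tasc, map_mul, ← mul_assoc, ih (by omega), shift_Tn hq (by omega)]
    rfl

theorem Tasc_mul_incl {q : ℂ} (hq : q ≠ 0) (r : ℕ) (x : Hecke q r) :
    Tasc q (r + 1) r * incl hq r x = shift hq r x * Tasc q (r + 1) r := by
  induction x using hecke_induction with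
  | algebraMap c => simpa using (Algebra.commutes c (Tasc q (r + 1) r)).symm
  | gen k hk => rw [incl_Tn hq hk, shift_Tn hq hk, Tasc_mul_Tn q (by omega) (by omega)]
  | mul x y hx hy => rw [map_mul, map_mul, ← mul_assoc, hx, mul_assoc, hy, mul_assoc]
  | add x y hx hy => rw [map_add, map_add, mul_add, add_mul, hx, hy]

/-- The `q`-number `1 + q⁻² + ⋯ + q^{-2(r-1)}`. -/
def qNum (q : ℂ) (r : ℕ) : ℂ := ∑ j ∈ Finset.range r, (q⁻¹ ^ 2) ^ j

theorem IsSignIdem.recursion {q : ℂ} (hq : q ≠ 0) {r : ℕ} {e : Hecke q (r + 1)}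
    {f : Hecke q r} (he : IsSignIdem e) (hf : IsSignIdem f) :
    qNum q (r + 1) • e +
      (q⁻¹ * qNum q r) • (shift hq r f * Tn q (r + 1) 0 * shift hq r f) = shift hq r f := by
  set B := shift hq r f with hB
  have hBB : B * B = B := by rw [hB, ← map_mul, hf.idem]
  have hTB : ∀ k, k + 1 < r → Tn q (r + 1) (k + 1) * B = (-q⁻¹) • B := by
    intro k hk
    rw [hB, ← shift_Tn hq (by omega), ← map_mul, hf.gen_mul k (by omega), map_smul]
  have hBT : ∀ k, k + 1 < r → B * Tn q (r + 1) (k + 1) = (-q⁻¹) • B := by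
    intro k hk
    rw [hB, ← shift_Tn hq (by omega), ← map_mul, hf.mul_gen k (by omega), map_smul]
  have hsB : sgn hq (r + 1) B = 1 := by rw [hB, sgn_shift, hf.sgn_eq_one hq]
  have hBe : B * e = e := by rw [eq_sgn_smul_mul hq he.gen_mul, hsB, one_smul]
  have heB : e * B = e := by rw [mul_eq_sgn_smul hq he.mul_gen, hsB, one_smul]
  set S : Hecke q (r + 1) :=
    ∑ j ∈ Finset.range (r + 1), ((-q⁻¹) ^ j) • Tasc q (r + 1) j with hS
  have hBS : ∀ k < r + 1 - 1, B * S * Tn q (r + 1) k = (-q⁻¹) • (B * S) := by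
    intro k hk
    rw [← sub_eq_zero, hS, Finset.mul_sum, Finset.sum_mul, Finset.smul_sum,
      ← Finset.sum_sub_distrib, Finset.sum_eq_add k (k + 1) (by omega)]
    · have h1 : Tasc q (r + 1) (k + 1) = Tasc q (r + 1) k * Tn q (r + 1) k := rfl
      have h2 : Tasc q (r + 1) (k + 1) * Tn q (r + 1) k =
          (q - q⁻¹) • Tasc q (r + 1) (k + 1) + Tasc q (r + 1) k := by
        rw [h1, mul_assoc, Tn_quad hq hk, mul_add, mul_one, mul_smul_comm]
      simp only [mul_smul_comm, smul_mul_assoc, mul_assoc, h2, ← h1, mul_add, smul_add, smul_smul]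
      have hqi : q * q⁻¹ = 1 := mul_inv_cancel₀ hq
      match_scalars
      · linear_combination (-(-q⁻¹) ^ k * hqi)
      · ring
    · intro c hc hck
      simp only [Finset.mem_range] at hc
      rw [mul_smul_comm, smul_mul_assoc, mul_assoc, sub_eq_zero, smul_comm]
      congr 1
      rcases Nat.lt_or_ge c k with h | h
      · obtain ⟨k, rfl⟩ : ∃ k', k = k' + 1 := ⟨k - 1, by omega⟩
        rw [(commute_Tasc_Tn q _ h).eq, ← mul_assoc, hBT k (by omega), smul_mul_assoc]
      · rw [Tasc_mul_Tn q (by omega) (by omega), ← mul_assoc, hBT k (by omega), smul_mul_assoc]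
    · intro h; simp at h; omega
    · intro h; simp at h; omega
  have hSe : S * e = qNum q (r + 1) • e := by
    rw [eq_sgn_smul_mul hq he.gen_mul, hS, map_sum, qNum]
    congr 1
    refine Finset.sum_congr rfl fun j hj => ?_
    have : ∀ j ≤ r, sgn hq (r + 1) (Tasc q (r + 1) j) = (-q⁻¹) ^ j := by
      intro j
      induction j with
      | zero => simp [Tasc]
      | succ j ih =>
        intro hj
        rw [Tasc, map_mul, ih (by omega), sgn_Tn hq (by omega), pow_succ]
    rw [map_smul, this j (by simpa [Nat.lt_succ_iff] using hj), smul_eq_mul, ← mul_pow]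
    congr 1
    ring
  have h1 : B * S = qNum q (r + 1) • e := by
    have := mul_eq_sgn_smul hq hBS e
    rw [he.sgn_eq_one hq, one_smul, mul_assoc, hSe, mul_smul_comm, hBe] at this
    exact this.symm
  have hTj : ∀ j < r, Tasc q (r + 1) (j + 1) * B = ((-q⁻¹) ^ j) • (Tn q (r + 1) 0 * B) := by
    intro j
    induction j with
    | zero => intro _; simp [Tasc]
    | succ j ih =>
      intro hj
      rw [Tasc, mul_assoc, hTB j hj, mul_smul_comm, ih (by omega), smul_smul, pow_succ']
  have h2 : S * B = (-(q⁻¹ * qNum q r)) • (Tn q (r + 1) 0 * B) + B := by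
    rw [hS, Finset.sum_range_succ', add_mul, Finset.sum_mul]
    congr 1
    · rw [qNum, Finset.mul_sum, ← Finset.sum_neg_distrib, Finset.sum_smul]
      refine Finset.sum_congr rfl fun j hj => ?_
      rw [smul_mul_assoc, hTj j (by simpa using hj), smul_smul]
      congr 1
      rw [pow_succ, mul_right_comm, ← mul_pow]
      ring
    · simp [Tasc]
  have h3 : qNum q (r + 1) • e = (-(q⁻¹ * qNum q r)) • (B * Tn q (r + 1) 0 * B) + B := by
    calc qNum q (r + 1) • e = (qNum q (r + 1) • e) * B := by rw [smul_mul_assoc, heB]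
      _ = B * (S * B) := by rw [← h1, mul_assoc]
      _ = _ := by rw [h2, mul_add, hBB, mul_smul_comm, mul_assoc]
  rw [h3, add_right_comm, ← add_smul, neg_add_cancel, zero_smul, zero_add]

/-! ### Reflection equation calculus -/

/-- Invertible elements `t_0, …, t_{N-1}` satisfying the braid relations together with an element
`l` satisfying the reflection equation with respect to `t_0`. -/
structure IsReflection {M : Type*} [Ring M] (N : ℕ) (t ti : ℕ → M) (l : M) : Prop where
  mul_inv : ∀ k < N, t k * ti k = 1
  inv_mul : ∀ k < N, ti k * t k = 1
  braid : ∀ k, k + 1 < N → t k * t (k + 1) * t k = t (k + 1) * t k * t (k + 1)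
  comm : ∀ j k, j + 1 < k → k < N → Commute (t j) (t k)
  comm_l : ∀ k < N, 0 < k → Commute (t k) l
  refl : 0 < N → t 0 * l * t 0 * l = l * t 0 * l * t 0

/-- The elements `t_{k-1} ⋯ t_0 l t_0⁻¹ ⋯ t_{k-1}⁻¹`. -/
def bar {M : Type*} [Ring M] (t ti : ℕ → M) (l : M) : ℕ → M
  | 0 => l
  | k + 1 => t k * bar t ti l k * ti k

namespace IsReflection

variable {M : Type*} [Ring M] {N : ℕ} {t ti : ℕ → M} {l : M}

theorem commute_inv (h : IsReflection N t ti l) {k : ℕ} (hk : k < N) {x : M}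
    (hx : Commute (t k) x) : Commute (ti k) x := by
  calc ti k * x = ti k * (x * t k) * ti k := by
        rw [mul_assoc, mul_assoc, h.mul_inv k hk, mul_one]
    _ = x * ti k := by rw [← hx.eq, ← mul_assoc, h.inv_mul k hk, one_mul]

theorem t_mul_bar (h : IsReflection N t ti l) {k : ℕ} (hk : k < N) :
    t k * bar t ti l k = bar t ti l (k + 1) * t k := by
  rw [bar, mul_assoc _ (ti k), h.inv_mul k hk, mul_one]

theorem commute_bar_of_lt (h : IsReflection N t ti l) {j k : ℕ} (hjk : j < k) (hk : k < N) :
    Commute (t k) (bar t ti l j) := by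
  induction j with
  | zero => exact h.comm_l k hk hjk
  | succ j ih =>
    have h1 : Commute (t j) (t k) := h.comm j k hjk hk
    exact (h1.symm.mul_right (ih (by omega))).mul_right (h.commute_inv (by omega) h1).symm

theorem commute_bar_of_gt (h : IsReflection N t ti l) {j k : ℕ} (hjk : k + 1 < j) (hj : j ≤ N) :
    Commute (t k) (bar t ti l j) := by
  induction j with
  | zero => omega
  | succ j ih =>
    rcases Nat.lt_or_ge (k + 1) j with h1 | h1
    · have h2 : Commute (t k) (t j) := h.comm k j h1 hj
      exact (h2.mul_right (ih h1 (by omega))).mul_right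
        (h.commute_inv (by omega) h2.symm).symm
    · obtain rfl : j = k + 1 := by omega
      have hb := h.commute_bar_of_lt (Nat.lt_succ_self k) hj
      have hinv : t (k + 1) * (ti k * ti (k + 1)) = ti k * ti (k + 1) * t k := by
        calc t (k + 1) * (ti k * ti (k + 1))
            = ti k * ti (k + 1) * (t (k + 1) * t k * t (k + 1)) * (ti k * ti (k + 1)) := by
              simp only [mul_assoc]
              rw [← mul_assoc (ti (k + 1)), h.inv_mul _ hj, one_mul, ← mul_assoc (ti k) (t k),
                h.inv_mul _ (by omega), one_mul]
          _ = ti k * ti (k + 1) * (t k * (t (k + 1) * (t k * ti k) * ti (k + 1))) := by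
              rw [← h.braid k hj]; simp only [mul_assoc]
          _ = _ := by
              rw [h.mul_inv k (by omega), mul_one, h.mul_inv _ hj, mul_one]
      calc t k * (t (k + 1) * (t k * bar t ti l k * ti k) * ti (k + 1))
          = t k * t (k + 1) * t k * bar t ti l k * (ti k * ti (k + 1)) := by
            simp only [mul_assoc]
        _ = t (k + 1) * t k * (bar t ti l k * (t (k + 1) * (ti k * ti (k + 1)))) := by
            rw [h.braid k hj, mul_assoc _ (t (k + 1)), hb.eq]; simp only [mul_assoc]
        _ = _ := by rw [hinv]; simp only [bar, mul_assoc]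

theorem refl_bar (h : IsReflection N t ti l) {k : ℕ} (hk : k < N) :
    t k * bar t ti l k * t k * bar t ti l k = bar t ti l k * t k * bar t ti l k * t k := by
  induction k with
  | zero => exact h.refl hk
  | succ k ih =>
    have ih := ih (by omega)
    have hb := h.commute_bar_of_lt (Nat.lt_succ_self k) hk
    set b := bar t ti l k with hbdef
    set z := t k * t (k + 1) with hz
    set zi := ti (k + 1) * ti k with hzi
    have hzz : zi * z = 1 := by
      rw [hz, hzi, mul_assoc, ← mul_assoc (ti k), h.inv_mul k (by omega), one_mul,
        h.inv_mul _ hk]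
    have h1 : t (k + 1) = z * t k * zi := by
      rw [hz, h.braid k hk, ← mul_assoc, mul_assoc _ (t (k + 1)) (ti (k + 1)), h.mul_inv _ hk,
        mul_one, mul_assoc, h.mul_inv k (by omega), mul_one]
    have h2 : bar t ti l (k + 1) = z * b * zi := by
      calc t k * b * ti k = t k * (b * (t (k + 1) * ti (k + 1))) * ti k := by
            rw [h.mul_inv _ hk, mul_one]
        _ = t k * (t (k + 1) * b) * ti (k + 1) * ti k := by rw [hb.eq]; simp only [mul_assoc]
        _ = _ := by simp only [hz, hzi, mul_assoc]
    have key : ∀ x y : M, z * x * zi * (z * y * zi) = z * (x * y) * zi := by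
      intro x y
      calc z * x * zi * (z * y * zi) = z * x * (zi * z) * y * zi := by simp only [mul_assoc]
        _ = _ := by rw [hzz, mul_one, mul_assoc z]
    rw [h2, h1, key, key, key, key, key, key, ih]

theorem commute_bar_mul_bar (h : IsReflection N t ti l) {k : ℕ} (hk : k < N) :
    Commute (t k) (bar t ti l k * bar t ti l (k + 1)) := by
  have h1 := h.refl_bar hk
  calc t k * (bar t ti l k * (t k * bar t ti l k * ti k))
      = t k * bar t ti l k * t k * bar t ti l k * ti k := by simp only [mul_assoc]
    _ = bar t ti l k * (t k * bar t ti l k * (t k * ti k)) := by rw [h1]; simp only [mul_assoc]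
    _ = bar t ti l k * (t k * bar t ti l k * (ti k * t k)) := by
      rw [h.mul_inv k hk, h.inv_mul k hk]
    _ = _ := by simp only [bar, mul_assoc]

theorem commute_prod_bar (h : IsReflection N t ti l) {k r : ℕ} (hk : k + 1 < r) (hr : r ≤ N + 1) :
    Commute (t k) ((List.range r).map (bar t ti l)).prod := by
  induction r with
  | zero => omega
  | succ r ih =>
    rw [List.range_succ, List.map_append, List.prod_append, List.map_singleton,
      List.prod_singleton]
    rcases Nat.lt_or_ge (k + 1) r with h1 | h1
    · exact (ih h1 (by omega)).mul_right (h.commute_bar_of_gt h1 (by omega))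
    · obtain rfl : r = k + 1 := by omega
      rw [List.range_succ, List.map_append, List.prod_append, List.map_singleton,
        List.prod_singleton, mul_assoc]
      refine Commute.mul_right (Commute.list_prod_right _ _ ?_) (h.commute_bar_mul_bar (by omega))
      intro x hx
      obtain ⟨j, hj, rfl⟩ := List.mem_map.1 hx
      exact h.commute_bar_of_lt (List.mem_range.1 hj) (by omega)

/-- The product `t_0 t_1 ⋯ t_{r-1}`. -/
def asc (t : ℕ → M) : ℕ → M
  | 0 => 1
  | j + 1 => asc t j * t j

theorem asc_mul_bar (h : IsReflection N t ti l) {j r : ℕ} (hj : j < r) (hr : r ≤ N) :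
    asc t r * bar t ti l j = bar t ti l (j + 1) * asc t r := by
  induction r with
  | zero => omega
  | succ r ih =>
    rcases Nat.lt_or_ge j r with h1 | h1
    · rw [asc, mul_assoc, (h.commute_bar_of_lt h1 hr).eq, ← mul_assoc, ih h1 (by omega),
        mul_assoc]
    · obtain rfl : j = r := by omega
      have h2 : ∀ i ≤ j, Commute (asc t i) (bar t ti l (j + 1)) := by
        intro i
        induction i with
        | zero => intro _; exact Commute.one_left _
        | succ i ih =>
          intro hi
          exact (ih (by omega)).mul_left (h.commute_bar_of_gt (by omega) hr)
      rw [asc, mul_assoc, h.t_mul_bar hr, ← mul_assoc, (h2 j le_rfl).eq, mul_assoc]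

/-- `l · t_0 ⋯ t_{r-1} · (l_0 ⋯ l_{r-1}) = (l_0 ⋯ l_r) · t_0 ⋯ t_{r-1}`. -/
theorem mul_asc_mul_prod_bar (h : IsReflection N t ti l) {r : ℕ} (hr : r ≤ N) :
    l * (asc t r * ((List.range r).map (bar t ti l)).prod) =
      ((List.range (r + 1)).map (bar t ti l)).prod * asc t r := by
  have key : ∀ j ≤ r, asc t r * ((List.range j).map (bar t ti l)).prod =
      ((List.range j).map (fun i => bar t ti l (i + 1))).prod * asc t r := by
    intro j
    induction j with
    | zero => intro _; simp
    | succ j ih =>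
      intro hj
      simp only [List.range_succ, List.map_append, List.prod_append, List.map_singleton,
        List.prod_singleton]
      rw [← mul_assoc, ih (by omega), mul_assoc, h.asc_mul_bar (by omega) hr, mul_assoc]
  rw [key r le_rfl, List.range_succ_eq_map, List.map_cons, List.prod_cons, List.map_map, mul_assoc]
  rfl

end IsReflection

/-! ### Entries of `Ř` -/

/-- The off-diagonal coefficients of `Ř`. -/
def rA (q : ℂ) {n : ℕ} (x y : Fin n) : ℂ := if x = y then q else 1

/-- The diagonal coefficients of `Ř`. -/
def rB (q : ℂ) {n : ℕ} (x y : Fin n) : ℂ := if y < x then q - q⁻¹ else 0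

theorem Rcheck_apply (q : ℂ) (n : ℕ) (p r : Fin n × Fin n) :
    Rcheck q n p r = (if r = p.swap then rA q p.1 p.2 else 0) +
      (if r = p then rB q p.1 p.2 else 0) := by
  obtain ⟨a, b⟩ := p
  obtain ⟨c, d⟩ := r
  have h : Rcheck q n (a, b) (c, d) = Rmat q n (b, a) (c, d) := by
    rw [Rcheck, Matrix.mul_apply, Finset.sum_eq_single (b, a)]
    · simp [Pmat]
    · rintro ⟨x, y⟩ _ hxy
      rw [Pmat, if_neg, zero_mul]
      rintro ⟨h1, h2⟩
      exact hxy (by simp_all)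
    · simp
  rw [h]
  simp only [Rmat, rA, rB, Prod.swap_prod_mk, Prod.mk.injEq]
  by_cases h1 : c = b ∧ d = a
  · obtain ⟨rfl, rfl⟩ := h1
    by_cases h2 : d = c
    · subst h2; simp
    · simp [h2, Ne.symm h2]
  · rw [if_neg (by tauto), if_neg h1, zero_add]
    by_cases h2 : c = a ∧ d = b
    · obtain ⟨rfl, rfl⟩ := h2
      simp
    · rw [if_neg (by tauto), if_neg h2]

theorem Rcheck_mul_apply (q : ℂ) (n : ℕ) (X : Matrix (Fin n × Fin n) (Fin n × Fin n) ℂ)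
    (p r : Fin n × Fin n) :
    (Rcheck q n * X) p r = rA q p.1 p.2 * X p.swap r + rB q p.1 p.2 * X p r := by
  simp [Matrix.mul_apply, Rcheck_apply, add_mul, Finset.sum_add_distrib]

theorem Rcheck_mul_self {q : ℂ} (hq : q ≠ 0) (n : ℕ) :
    Rcheck q n * (Rcheck q n - (q - q⁻¹) • 1) = 1 := by
  ext p r
  rw [Rcheck_mul_apply]
  simp only [Matrix.sub_apply, Matrix.smul_apply, Matrix.one_apply, Rcheck_apply, Prod.swap_swap,
    smul_eq_mul, Prod.fst_swap, Prod.snd_swap]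
  have hqi : q * q⁻¹ = 1 := mul_inv_cancel₀ hq
  obtain ⟨a, b⟩ := p
  obtain ⟨c, d⟩ := r
  simp only [rA, rB, Prod.swap_prod_mk, Prod.mk.injEq, eq_comm (a := b) (b := a),
    eq_comm (a := b) (b := c), eq_comm (a := a) (b := c), eq_comm (a := b) (b := d),
    eq_comm (a := a) (b := d)]
  rcases lt_trichotomy a b with h | h | h
  · have h1 := h.ne
    have h2 := h.not_gt
    split_ifs <;> simp_all
  · subst h
    split_ifs <;> simp_all
  · have h1 := h.ne'
    have h2 := h.not_gt
    split_ifs <;> simp_all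

theorem Rcheck_inv {q : ℂ} (hq : q ≠ 0) (n : ℕ) :
    (Rcheck q n)⁻¹ = Rcheck q n - (q - q⁻¹) • 1 :=
  Matrix.inv_eq_right_inv (Rcheck_mul_self hq n)

/-! ### Matrices on tensor powers -/

/-- `(End ℂⁿ)^{⊗m} ⊗ A`. -/
abbrev TMat (A : Type) (n m : ℕ) := Matrix (Fin m → Fin n) (Fin m → Fin n) A

/-- A multi-index with one more entry appended. -/
def sn {n m : ℕ} (i : Fin m → Fin n) (x : Fin n) : Fin (m + 1) → Fin n :=
  Fin.snoc (α := fun _ => Fin n) i x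

theorem sn_of_lt {n m : ℕ} (i : Fin m → Fin n) (x : Fin n) {a : ℕ} (h : a < m)
    (h' : a < m + 1) : sn i x ⟨a, h'⟩ = i ⟨a, h⟩ := by
  simp [sn, Fin.snoc, h]

@[simp] theorem sn_castSucc {n m : ℕ} (i : Fin m → Fin n) (x : Fin n) (a : Fin m) :
    sn i x a.castSucc = i a := by
  simp [sn]

@[simp] theorem sn_last {n m : ℕ} (i : Fin m → Fin n) (x : Fin n) : sn i x (Fin.last m) = x := by
  simp [sn]

theorem sn_surjective {n m : ℕ} (i : Fin (m + 1) → Fin n) :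
    ∃ j x, i = sn j x :=
  ⟨Fin.init i, i (Fin.last m), (Fin.snoc_init_self i).symm⟩

theorem sn_inj {n m : ℕ} {i j : Fin m → Fin n} {x y : Fin n} :
    sn i x = sn j y ↔ i = j ∧ x = y := by
  constructor
  · intro h
    refine ⟨funext fun a => ?_, ?_⟩
    · simpa using congrFun h a.castSucc
    · simpa using congrFun h (Fin.last m)
  · rintro ⟨rfl, rfl⟩; rfl

theorem sum_sn {n m : ℕ} {B : Type*} [AddCommMonoid B] (f : (Fin (m + 1) → Fin n) → B) :
    ∑ i, f i = ∑ x, ∑ i, f (sn i x) := by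
  rw [← (Fin.snocEquiv fun _ : Fin (m + 1) => Fin n).sum_comp, Fintype.sum_prod_type]
  rfl

theorem ext_sn {A : Type} {n m : ℕ} {Y Z : TMat A n (m + 1)}
    (h : ∀ i j x y, Y (sn i x) (sn j y) = Z (sn i x) (sn j y)) : Y = Z := by
  ext i j
  obtain ⟨i, x, rfl⟩ := sn_surjective i
  obtain ⟨j, y, rfl⟩ := sn_surjective j
  exact h i j x y

/-- The underlying function of `emb`. -/
def embFun {A : Type} [Ring A] {n m : ℕ} (Y : TMat A n m) : TMat A n (m + 1) := fun i j =>
  if i (Fin.last m) = j (Fin.last m) then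
    Y (fun a => i a.castSucc) (fun a => j a.castSucc) else 0

theorem embFun_sn {A : Type} [Ring A] {n m : ℕ} (Y : TMat A n m) (i j : Fin m → Fin n) (x y : Fin n) :
    embFun Y (sn i x) (sn j y) = if x = y then Y i j else 0 := by
  simp [embFun]

section Legs

variable {A : Type} [Ring A] [Algebra ℂ A]

/-- `Y ↦ Y ⊗ 1`. -/
def emb (A : Type) [Ring A] [Algebra ℂ A] (n m : ℕ) : TMat A n m →ₐ[ℂ] TMat A n (m + 1) :=
  AlgHom.ofLinearMap
    { toFun := embFun
      map_add' := fun Y Z => ext_sn fun i j x y => by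
        simp only [Matrix.add_apply, embFun_sn]; split_ifs <;> simp
      map_smul' := fun c Y => ext_sn fun i j x y => by
        simp only [Matrix.smul_apply, embFun_sn, RingHom.id_apply]; split_ifs <;> simp }
    (ext_sn fun i j x y => by
      simp only [LinearMap.coe_mk, AddHom.coe_mk, Matrix.one_apply, embFun_sn, sn_inj]
      by_cases hxy : x = y <;> simp [hxy])
    (fun Y Z => ext_sn fun i j x y => by
      simp only [LinearMap.coe_mk, AddHom.coe_mk, Matrix.mul_apply, embFun_sn, sum_sn]
      by_cases hxy : x = y <;> simp [hxy])

theorem emb_sn {n m : ℕ} (Y : TMat A n m) (i j : Fin m → Fin n) (x y : Fin n) :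
    emb A n m Y (sn i x) (sn j y) = if x = y then Y i j else 0 :=
  embFun_sn Y i j x y

theorem emb_leg1 (n m : ℕ) (X : Matrix (Fin n) (Fin n) A) {a : ℕ} (ha : a < m) :
    emb A n m (leg1 n m X a) = leg1 n (m + 1) X a := by
  ext i j
  obtain ⟨i, x, rfl⟩ := sn_surjective i
  obtain ⟨j, y, rfl⟩ := sn_surjective j
  rw [emb_sn]
  by_cases hxy : x = y <;>
    simp [leg1, Fin.forall_fin_succ', ha, sn_of_lt _ _ ha, ha.trans (Nat.lt_succ_self m), hxy,
      show m ≠ a by omega]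

theorem emb_leg2 (n m : ℕ) (C : Matrix (Fin n × Fin n) (Fin n × Fin n) ℂ) {a b : ℕ} (ha : a < m)
    (hb : b < m) : emb A n m (leg2 A n m C a b) = leg2 A n (m + 1) C a b := by
  ext i j
  obtain ⟨i, x, rfl⟩ := sn_surjective i
  obtain ⟨j, y, rfl⟩ := sn_surjective j
  rw [emb_sn]
  by_cases hxy : x = y <;>
    simp [leg2, Fin.forall_fin_succ', ha, hb, sn_of_lt _ _ ha, sn_of_lt _ _ hb,
      ha.trans (Nat.lt_succ_self m), hb.trans (Nat.lt_succ_self m), hxy,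
      show m ≠ a by omega, show m ≠ b by omega]

/-- Exchange of the entries `k` and `k+1` of a multi-index. -/
def swp {n m : ℕ} (k : ℕ) (hk : k + 1 < m) (i : Fin m → Fin n) : Fin m → Fin n :=
  i ∘ Equiv.swap ⟨k, by omega⟩ ⟨k + 1, hk⟩

theorem swp_swp {n m k : ℕ} (hk : k + 1 < m) (i : Fin m → Fin n) :
    swp k hk (swp k hk i) = i := by
  ext a; simp [swp]

theorem eq_swp_iff {n m k : ℕ} (hk : k + 1 < m) (i j : Fin m → Fin n) :
    j = swp k hk i ↔ i = swp k hk j := by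
  constructor <;> (rintro rfl; rw [swp_swp])

theorem agree_eq_iff {n m : ℕ} {a b : ℕ} (ha : a < m) (hb : b < m) (i j : Fin m → Fin n) :
    ((∀ c : Fin m, (c : ℕ) ≠ a → (c : ℕ) ≠ b → i c = j c) ∧
      (j ⟨a, ha⟩, j ⟨b, hb⟩) = (i ⟨a, ha⟩, i ⟨b, hb⟩)) ↔ j = i := by
  constructor
  · rintro ⟨h1, h2⟩
    simp only [Prod.mk.injEq] at h2
    ext c
    by_cases hca : (c : ℕ) = a
    · obtain rfl : c = ⟨a, ha⟩ := Fin.ext hca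
      rw [h2.1]
    · by_cases hcb : (c : ℕ) = b
      · obtain rfl : c = ⟨b, hb⟩ := Fin.ext hcb
        rw [h2.2]
      · rw [h1 c hca hcb]
  · rintro rfl; simp

theorem agree_swp_iff {n m k : ℕ} (hk : k + 1 < m) (i j : Fin m → Fin n) :
    ((∀ c : Fin m, (c : ℕ) ≠ k → (c : ℕ) ≠ k + 1 → i c = j c) ∧
      (j ⟨k, by omega⟩, j ⟨k + 1, hk⟩) =
        (i ⟨k, by omega⟩, i ⟨k + 1, hk⟩).swap) ↔ j = swp k hk i := by
  rw [← agree_eq_iff (show k < m by omega) hk (swp k hk i) j]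
  have h1 : swp k hk i ⟨k, by omega⟩ = i ⟨k + 1, hk⟩ := by simp [swp]
  have h2 : swp k hk i ⟨k + 1, hk⟩ = i ⟨k, by omega⟩ := by simp [swp]
  rw [h1, h2]
  refine and_congr (forall_congr' fun c => ?_) Iff.rfl
  refine imp_congr_right fun hc => imp_congr_right fun hc' => ?_
  rw [swp, Function.comp_apply, Equiv.swap_apply_of_ne_of_ne]
  · exact fun h => hc (by rw [h])
  · exact fun h => hc' (by rw [h])

theorem RcLeg_apply (A : Type) [Ring A] [Algebra ℂ A] (q : ℂ) {n m k : ℕ} (hk : k + 1 < m)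
    (i j : Fin m → Fin n) :
    RcLeg A q n m k i j = algebraMap ℂ A
      ((if j = swp k hk i then rA q (i ⟨k, by omega⟩) (i ⟨k + 1, hk⟩) else 0) +
        (if j = i then rB q (i ⟨k, by omega⟩) (i ⟨k + 1, hk⟩) else 0)) := by
  have h1 := agree_swp_iff hk i j
  have h2 := agree_eq_iff (show k < m by omega) hk i j
  rw [RcLeg, leg2, dif_pos ⟨by omega, hk⟩, Rcheck_apply]
  simp only [← h1, ← h2]
  by_cases h : ∀ c : Fin m, (c : ℕ) ≠ k → (c : ℕ) ≠ k + 1 → i c = j c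
  · rw [if_pos h]
    simp only [eq_true h, true_and]
  · rw [if_neg h, if_neg fun h' => h h'.1, if_neg fun h' => h h'.1, add_zero, map_zero]

theorem RcLeg_symm (A : Type) [Ring A] [Algebra ℂ A] (q : ℂ) {n m k : ℕ} (hk : k + 1 < m)
    (i j : Fin m → Fin n) : RcLeg A q n m k i j = RcLeg A q n m k j i := by
  rw [RcLeg_apply A q hk, RcLeg_apply A q hk]
  congr 2
  · by_cases h : j = swp k hk i
    · rw [if_pos h, if_pos ((eq_swp_iff hk i j).1 h)]
      subst h
      simp [swp, rA, eq_comm]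
    · rw [if_neg h, if_neg fun h' => h ((eq_swp_iff hk i j).2 h')]
  · by_cases h : j = i
    · rw [if_pos h, if_pos h.symm, h]
    · rw [if_neg h, if_neg (Ne.symm h)]

theorem leg2_sub_smul_one (A : Type) [Ring A] [Algebra ℂ A] {n m a b : ℕ} (ha : a < m) (hb : b < m)
    (C : Matrix (Fin n × Fin n) (Fin n × Fin n) ℂ) (c : ℂ) :
    leg2 A n m (C - c • 1) a b = leg2 A n m C a b - c • 1 := by
  ext i j
  have h := agree_eq_iff ha hb i j
  rw [Matrix.sub_apply, Matrix.smul_apply, leg2, leg2, dif_pos ⟨ha, hb⟩, dif_pos ⟨ha, hb⟩]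
  by_cases h1 : ∀ c : Fin m, (c : ℕ) ≠ a → (c : ℕ) ≠ b → i c = j c
  · rw [if_pos h1, if_pos h1, Matrix.sub_apply, Matrix.smul_apply, map_sub]
    congr 1
    by_cases h2 : j = i
    · subst h2
      simp [Algebra.smul_def]
    · rw [Matrix.one_apply_ne (Ne.symm h2), Matrix.one_apply_ne, smul_zero, smul_zero, map_zero]
      exact fun h3 => h2 (h.1 ⟨h1, h3.symm⟩)
  · rw [if_neg h1, if_neg h1, Matrix.one_apply_ne, smul_zero, sub_zero]
    rintro rfl
    exact h1 fun _ _ _ => rfl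

theorem RcLegInv_eq (A : Type) [Ring A] [Algebra ℂ A] {q : ℂ} (hq : q ≠ 0) {n m k : ℕ}
    (hk : k + 1 < m) : RcLegInv A q n m k = RcLeg A q n m k - (q - q⁻¹) • 1 := by
  rw [RcLegInv, Rcheck_inv hq, leg2_sub_smul_one A (by omega) hk, RcLeg]

theorem RcLeg_mul_apply (q : ℂ) {n m k : ℕ} (hk : k + 1 < m) (Z : TMat A n m)
    (i j : Fin m → Fin n) :
    (RcLeg A q n m k * Z) i j =
      rA q (i ⟨k, by omega⟩) (i ⟨k + 1, hk⟩) • Z (swp k hk i) j +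
        rB q (i ⟨k, by omega⟩) (i ⟨k + 1, hk⟩) • Z i j := by
  simp only [Matrix.mul_apply, RcLeg_apply A q hk, ← Algebra.smul_def, add_smul,
    Finset.sum_add_distrib, ite_smul, zero_smul]
  simp

theorem mul_RcLeg_apply (q : ℂ) {n m k : ℕ} (hk : k + 1 < m) (Z : TMat A n m)
    (i j : Fin m → Fin n) :
    (Z * RcLeg A q n m k) i j =
      rA q (j ⟨k, by omega⟩) (j ⟨k + 1, hk⟩) • Z i (swp k hk j) +
        rB q (j ⟨k, by omega⟩) (j ⟨k + 1, hk⟩) • Z i j := by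
  simp only [Matrix.mul_apply, fun l => RcLeg_symm A q hk l j, RcLeg_apply A q hk,
    ← Algebra.commutes, ← Algebra.smul_def, add_smul,
    Finset.sum_add_distrib, ite_smul, zero_smul]
  simp

theorem swp_sn_sn {n m : ℕ} (i : Fin m → Fin n) (x y : Fin n) (h : m + 1 < m + 2) :
    swp m h (sn (sn i x) y) = sn (sn i y) x := by
  have e1 : (⟨m, by omega⟩ : Fin (m + 2)) = (Fin.last m).castSucc := rfl
  have e2 : (⟨m + 1, h⟩ : Fin (m + 2)) = Fin.last (m + 1) := rfl
  ext c
  rw [swp, e1, e2, Function.comp_apply]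
  refine Fin.lastCases ?_ (fun c => ?_) c
  · simp
  · refine Fin.lastCases ?_ (fun c => ?_) c
    · simp
    · rw [Equiv.swap_apply_of_ne_of_ne]
      · simp
      · exact fun h => (Fin.castSucc_lt_last c).ne (Fin.castSucc_injective _ h)
      · exact (Fin.castSucc_lt_last _).ne

/-! ### Partial `q`-traces -/

/-- The diagonal entries of `D`. -/
def dw (q : ℂ) {n : ℕ} (x : Fin n) : ℂ := q ^ (-2 * ((x : ℕ) : ℤ))

/-- The partial `q`-trace over the last tensor factor. -/
def ptr (q : ℂ) {n m : ℕ} (Y : TMat A n (m + 1)) : TMat A n m :=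
  fun i j => ∑ x, dw q x • Y (sn i x) (sn j x)

theorem qTr_eq (q : ℂ) {n m : ℕ} (Y : TMat A n m) :
    qTr q n m Y = ∑ i, (∏ a, dw q (i a)) • Y i i := by
  simp only [qTr, Algebra.smul_def, dw]

theorem qTr_ptr (q : ℂ) {n m : ℕ} (Y : TMat A n (m + 1)) :
    qTr q n (m + 1) Y = qTr q n m (ptr q Y) := by
  rw [qTr_eq, qTr_eq, sum_sn, Finset.sum_comm]
  refine Finset.sum_congr rfl fun i _ => ?_
  simp [ptr, Finset.smul_sum, Fin.prod_univ_castSucc, smul_smul]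

theorem ptr_emb_mul (q : ℂ) {n m : ℕ} (Y : TMat A n m) (Z : TMat A n (m + 1)) :
    ptr q (emb A n m Y * Z) = Y * ptr q Z := by
  ext i j
  simp only [ptr, Matrix.mul_apply, sum_sn, emb_sn, ite_mul, zero_mul, Finset.mul_sum,
    mul_smul_comm, Finset.smul_sum]
  rw [Finset.sum_comm (s := Finset.univ (α := Fin m → Fin n))]
  refine Finset.sum_congr rfl fun x _ => ?_
  rw [Finset.sum_comm]
  simp

theorem ptr_mul_emb (q : ℂ) {n m : ℕ} (Y : TMat A n m) (Z : TMat A n (m + 1)) :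
    ptr q (Z * emb A n m Y) = ptr q Z * Y := by
  ext i j
  simp only [ptr, Matrix.mul_apply, sum_sn, emb_sn, mul_ite, mul_zero, Finset.sum_mul,
    smul_mul_assoc, Finset.smul_sum]
  rw [Finset.sum_comm (s := Finset.univ (α := Fin m → Fin n))]
  refine Finset.sum_congr rfl fun x _ => ?_
  rw [Finset.sum_comm]
  simp

theorem sum_dw_rB {q : ℂ} (hq : q ≠ 0) {n : ℕ} (x : Fin n) :
    ∑ a, dw q a * rB q x a = q * (1 - dw q x) := by
  have h : ∀ N ≤ n, ∑ a : Fin n, (if (a : ℕ) < N then dw q a * (q - q⁻¹) else 0) =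
      q * (1 - q ^ (-2 * (N : ℤ))) := by
    intro N hN
    induction N with
    | zero => simp
    | succ N ih =>
      have h1 : ∀ a : Fin n, (if (a : ℕ) < N + 1 then dw q a * (q - q⁻¹) else 0) =
          (if (a : ℕ) < N then dw q a * (q - q⁻¹) else 0) +
            (if a = ⟨N, hN⟩ then dw q a * (q - q⁻¹) else 0) := by
        intro a
        rcases lt_trichotomy (a : ℕ) N with h | h | h
        · rw [if_pos (by omega), if_pos h, if_neg (fun h' => by simp [h'] at h), add_zero]
        · rw [if_pos (by omega), if_neg (by omega), if_pos (Fin.ext h), zero_add]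
        · rw [if_neg (by omega), if_neg (by omega), if_neg (fun h' => by simp [h'] at h), add_zero]
      rw [Finset.sum_congr rfl fun a _ => h1 a, Finset.sum_add_distrib, ih (by omega),
        Finset.sum_ite_eq' Finset.univ, if_pos (Finset.mem_univ _), dw]
      have h2 : q ^ (-2 * ((N + 1 : ℕ) : ℤ)) = q ^ (-2 * (N : ℤ)) * q⁻¹ ^ 2 := by
        rw [Nat.cast_succ, mul_add, zpow_add₀ hq, inv_pow, mul_one]
        rfl
      rw [h2]
      field_simp
      ring
  rw [dw, ← h x x.2.le]
  refine Finset.sum_congr rfl fun a _ => ?_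
  by_cases hax : (a : ℕ) < x
  · rw [rB, if_pos (show a < x from hax), if_pos hax]
  · rw [rB, if_neg (show ¬ a < x from hax), if_neg hax, mul_zero]

theorem ptr_RcLeg_last {q : ℂ} (hq : q ≠ 0) (A : Type) [Ring A] [Algebra ℂ A] (n m : ℕ) :
    ptr q (RcLeg A q n (m + 2) m) = q • (1 : TMat A n (m + 1)) := by
  refine ext_sn fun i j x y => ?_
  have h1 : ∀ (i : Fin m → Fin n) (x a : Fin n),
      sn (sn i x) a ⟨m, by omega⟩ = x := fun i x a => by
    have : (⟨m, by omega⟩ : Fin (m + 2)) = (Fin.last m).castSucc := rfl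
    simp [this]
  have h2 : ∀ (i : Fin m → Fin n) (x a : Fin n),
      sn (sn i x) a ⟨m + 1, by omega⟩ = a := fun i x a => by
    have : (⟨m + 1, by omega⟩ : Fin (m + 2)) = Fin.last (m + 1) := rfl
    simp [this]
  simp only [ptr, RcLeg_apply A q (show m + 1 < m + 2 by omega), swp_sn_sn, sn_inj, h1, h2,
    Matrix.smul_apply, Matrix.one_apply]
  by_cases hij : j = i
  · by_cases hxy : y = x
    · subst hij hxy
      simp only [true_and, and_true, if_true]
      have h3 : ∀ a : Fin n, dw q a • algebraMap ℂ A
          ((if y = a ∧ a = y then rA q y a else 0) + rB q y a) =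
          algebraMap ℂ A ((if a = y then dw q a * rA q y a else 0) + dw q a * rB q y a) := by
        intro a
        rw [Algebra.smul_def, ← map_mul, mul_add]
        congr 2
        by_cases h : a = y
        · simp [h]
        · simp [h]
      rw [Finset.sum_congr rfl fun a _ => h3 a, ← map_sum, Finset.sum_add_distrib, sum_dw_rB hq,
        Finset.sum_ite_eq' Finset.univ, if_pos (Finset.mem_univ _), rA, if_pos rfl,
        Algebra.smul_def, mul_one]
      congr 1
      ring
    · have h3 : ∀ a, ¬ ((j = i ∧ y = a) ∧ a = x) := fun a h => hxy (h.1.2.trans h.2)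
      simp only [hxy, h3, Ne.symm hxy, and_false, false_and, if_false, add_zero, map_zero,
        smul_zero, Finset.sum_const_zero]
  · simp [hij, Ne.symm hij]

theorem sum_dw_rB_mul_rB {q : ℂ} (hq : q ≠ 0) {n : ℕ} {x y : Fin n} (h : x ≤ y) :
    ∑ a, dw q a * (rB q x a * rB q y a) = (q - q⁻¹) * (q * (1 - dw q x)) := by
  rw [← sum_dw_rB hq, Finset.mul_sum]
  refine Finset.sum_congr rfl fun a _ => ?_
  by_cases ha : a < x
  · rw [rB, rB, if_pos ha, if_pos (ha.trans_le h)]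
    ring
  · rw [rB, if_neg ha]
    ring

theorem ptr_RcLeg_conj {q : ℂ} (hq : q ≠ 0) {n m : ℕ} (Y : TMat A n (m + 1)) :
    ptr q (RcLeg A q n (m + 2) m * emb A n (m + 1) Y * RcLegInv A q n (m + 2) m) =
      emb A n m (ptr q Y) := by
  refine ext_sn fun i j x y => ?_
  have h1 : ∀ (i : Fin m → Fin n) (x a : Fin n),
      sn (sn i x) a ⟨m, by omega⟩ = x := fun i x a => by
    have : (⟨m, by omega⟩ : Fin (m + 2)) = (Fin.last m).castSucc := rfl
    simp [this]
  have h2 : ∀ (i : Fin m → Fin n) (x a : Fin n),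
      sn (sn i x) a ⟨m + 1, by omega⟩ = a := fun i x a => by
    have : (⟨m + 1, by omega⟩ : Fin (m + 2)) = Fin.last (m + 1) := rfl
    simp [this]
  have hm : m + 1 < m + 2 := by omega
  rw [RcLegInv_eq A hq hm, mul_sub, mul_smul_comm, mul_one, mul_assoc, emb_sn]
  simp only [ptr, Matrix.sub_apply, Matrix.smul_apply, RcLeg_mul_apply q hm, mul_RcLeg_apply q hm,
    swp_sn_sn, emb_sn, h1, h2, if_true]
  have key : ∀ F : Fin n → Fin n → A, ∑ a, dw q a •
      (rA q x a • (rA q y a • (if x = y then F a a else 0) +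
          rB q y a • (if x = a then F a y else 0)) +
        rB q x a • (rA q y a • (if a = y then F x a else 0) +
          rB q y a • F x y) -
        (q - q⁻¹) • (rA q x a • (if x = a then F a y else 0) +
          rB q x a • F x y)) =
      if x = y then ∑ a, dw q a • F a a else 0 := by
    intro F
    have h3 : ∀ a, dw q a •
      (rA q x a • (rA q y a • (if x = y then F a a else 0) +
          rB q y a • (if x = a then F a y else 0)) +
        rB q x a • (rA q y a • (if a = y then F x a else 0) +
          rB q y a • F x y) -
        (q - q⁻¹) • (rA q x a • (if x = a then F a y else 0) +
          rB q x a • F x y)) =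
        (if x = y then (dw q a * rA q x a * rA q y a) • F a a else 0) +
        ((if a = x then dw q a * q * (rB q y x - (q - q⁻¹)) else 0) +
          (if a = y then dw q a * q * rB q x y else 0) +
          dw q a * (rB q x a * rB q y a) - (q - q⁻¹) * (dw q a * rB q x a)) • F x y := by
      intro a
      have e1 : (if x = a then F a y else 0) = (if a = x then (1 : ℂ) else 0) • F x y := by
        by_cases h : x = a
        · subst h; simp
        · simp [h, Ne.symm h]
      have e2 : (if a = y then F x a else 0) = (if a = y then (1 : ℂ) else 0) • F x y := by
        by_cases h : a = y
        · subst h; simp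
        · simp [h]
      have e3 : (if x = y then F a a else 0) = (if x = y then (1 : ℂ) else 0) • F a a := by
        by_cases h : x = y <;> simp [h]
      have e4 : (if x = y then (dw q a * rA q x a * rA q y a) • F a a else 0) =
          ((if x = y then (1 : ℂ) else 0) * (dw q a * rA q x a * rA q y a)) • F a a := by
        by_cases h : x = y <;> simp [h]
      have e5 : (if a = x then dw q a * q * (rB q y x - (q - q⁻¹)) else 0) =
          (if a = x then (1 : ℂ) else 0) * (dw q a * rA q x a * (rB q y a - (q - q⁻¹))) := by
        by_cases h : a = x
        · subst h; simp [rA]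
        · simp [h]
      have e6 : (if a = y then dw q a * q * rB q x y else 0) =
          (if a = y then (1 : ℂ) else 0) * (dw q a * rA q y a * rB q x a) := by
        by_cases h : a = y
        · subst h; simp [rA]
        · simp [h]
      rw [e1, e2, e3, e4, e5, e6]
      module
    rw [Finset.sum_congr rfl fun a _ => h3 a, Finset.sum_add_distrib, ← Finset.sum_smul,
      Finset.sum_sub_distrib, Finset.sum_add_distrib, Finset.sum_add_distrib,
      Finset.sum_ite_eq' Finset.univ, Finset.sum_ite_eq' Finset.univ, if_pos (Finset.mem_univ _),
      if_pos (Finset.mem_univ _), ← Finset.mul_sum, sum_dw_rB hq]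
    have hqi : q * q⁻¹ = 1 := mul_inv_cancel₀ hq
    rcases lt_trichotomy x y with h | h | h
    · simp only [if_neg h.ne, Finset.sum_const_zero, zero_add]
      rw [sum_dw_rB_mul_rB hq h.le, rB, rB, if_pos h, if_neg h.not_gt]
      convert zero_smul ℂ _
      ring
    · subst h
      simp only [if_true]
      rw [sum_dw_rB_mul_rB hq le_rfl, rB, if_neg (lt_irrefl x)]
      have h4 : ∀ a, (dw q a * rA q x a * rA q x a) • F a a = dw q a • F a a +
          (if a = x then (dw q a * (q ^ 2 - 1)) • F a a else 0) := by
        intro a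
        by_cases h : a = x
        · subst h
          rw [rA, if_pos rfl, if_pos rfl]
          module
        · rw [rA, if_neg h, if_neg (Ne.symm h)]
          simp
      rw [Finset.sum_congr rfl fun a _ => h4 a, Finset.sum_add_distrib,
        Finset.sum_ite_eq' Finset.univ, if_pos (Finset.mem_univ _), add_assoc, ← add_smul]
      convert add_zero _
      convert zero_smul ℂ _
      linear_combination (dw q x) * hqi
    · simp only [if_neg h.ne', Finset.sum_const_zero, zero_add]
      have h4 := sum_dw_rB_mul_rB hq h.le
      simp only [mul_comm (rB q y _)] at h4
      rw [h4, rB, rB, if_pos h, if_neg h.not_gt]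
      convert zero_smul ℂ _
      ring
  exact key fun a b => Y (sn i a) (sn j b)

/-! ### Representations of the Hecke algebras on tensor powers -/

theorem qTr_add (q : ℂ) {n m : ℕ} (Y Z : TMat A n m) :
    qTr q n m (Y + Z) = qTr q n m Y + qTr q n m Z := by
  simp [qTr, mul_add, Finset.sum_add_distrib]

theorem qTr_smul (q : ℂ) {n m : ℕ} (c : ℂ) (Y : TMat A n m) :
    qTr q n m (c • Y) = c • qTr q n m Y := by
  simp [qTr, Finset.smul_sum]

theorem qTr_RcLeg_comm (q : ℂ) {n m k : ℕ} (hk : k + 1 < m) (Y : TMat A n m) :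
    qTr q n m (RcLeg A q n m k * Y) = qTr q n m (Y * RcLeg A q n m k) := by
  rw [qTr_eq, qTr_eq]
  simp only [RcLeg_mul_apply q hk, mul_RcLeg_apply q hk, smul_add, Finset.sum_add_distrib]
  congr 1
  have hinv : Function.Involutive (swp (n := n) k hk) := swp_swp hk
  rw [← Equiv.sum_comp hinv.toPerm]
  refine Finset.sum_congr rfl fun i _ => ?_
  rw [Function.Involutive.coe_toPerm, swp_swp]
  have h1 : swp k hk i ⟨k, by omega⟩ = i ⟨k + 1, hk⟩ := by simp [swp]
  have h2 : swp k hk i ⟨k + 1, hk⟩ = i ⟨k, by omega⟩ := by simp [swp]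
  have h3 : ∏ a, dw q (swp k hk i a) = ∏ a, dw q (i a) :=
    Equiv.prod_comp (Equiv.swap (⟨k, by omega⟩ : Fin m) ⟨k + 1, hk⟩) fun a => dw q (i a)
  rw [h1, h2, h3, rA, rA]
  by_cases h : i ⟨k, by omega⟩ = i ⟨k + 1, hk⟩
  · rw [if_pos h, if_pos h.symm]
  · rw [if_neg h, if_neg (Ne.symm h)]

theorem commute_RcLeg_leg1 (q : ℂ) {n m k : ℕ} (hk : k + 1 < m) (hk0 : 0 < k)
    (X : Matrix (Fin n) (Fin n) A) : Commute (RcLeg A q n m k) (leg1 n m X 0) := by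
  rw [commute_iff_eq]
  ext i j
  rw [RcLeg_mul_apply q hk, mul_RcLeg_apply q hk]
  have hm : 0 < m := by omega
  have hval : ∀ i : Fin m → Fin n, swp k hk i ⟨0, hm⟩ = i ⟨0, hm⟩ := by
    intro i
    rw [swp, Function.comp_apply, Equiv.swap_apply_of_ne_of_ne]
    · exact fun h => hk0.ne (Fin.mk.inj_iff.1 h)
    · exact fun h => Nat.succ_ne_zero k (Fin.mk.inj_iff.1 h).symm
  have hs : ∀ i : Fin m → Fin n, swp k hk i ⟨k, by omega⟩ = i ⟨k + 1, hk⟩ ∧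
      swp k hk i ⟨k + 1, hk⟩ = i ⟨k, by omega⟩ := fun i => by simp [swp]
  have himp : ∀ i j : Fin m → Fin n, (∀ c : Fin m, (c : ℕ) ≠ 0 → swp k hk i c = j c) →
      (∀ c : Fin m, (c : ℕ) ≠ 0 → i c = swp k hk j c) := by
    intro i j h c hc
    have h' := h (Equiv.swap ⟨k, by omega⟩ ⟨k + 1, hk⟩ c) ?_
    · simpa [swp] using h'
    · by_cases h1 : c = ⟨k, by omega⟩
      · rw [h1, Equiv.swap_apply_left]; simp
      · by_cases h2 : c = ⟨k + 1, hk⟩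
        · rw [h2, Equiv.swap_apply_right]; simp; omega
        · rwa [Equiv.swap_apply_of_ne_of_ne h1 h2]
  have hZ : leg1 n m X 0 (swp k hk i) j = leg1 n m X 0 i (swp k hk j) := by
    rw [leg1, leg1, dif_pos hm, dif_pos hm, hval, hval]
    refine if_congr ⟨himp i j, fun h c hc => ?_⟩ rfl rfl
    exact (himp j i (fun c hc => (h c hc).symm) c hc).symm
  congr 1
  · rw [hZ, leg1, dif_pos hm]
    by_cases h : ∀ c : Fin m, (c : ℕ) ≠ 0 → i c = swp k hk j c
    · have h1 := h ⟨k, by omega⟩ (by simp; omega)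
      have h2 := h ⟨k + 1, hk⟩ (by simp)
      rw [(hs j).1] at h1
      rw [(hs j).2] at h2
      rw [if_pos h, h1, h2, rA, rA]
      simp only [eq_comm]
    · rw [if_neg h, smul_zero, smul_zero]
  · rw [leg1, dif_pos hm]
    by_cases h : ∀ c : Fin m, (c : ℕ) ≠ 0 → i c = j c
    · rw [h ⟨k, by omega⟩ (by simp; omega), h ⟨k + 1, hk⟩ (by simp)]
    · rw [if_neg h, smul_zero, smul_zero]

/-- `Φ m` sends `T_k` to `Ř_k` for all `m`. -/
def IsRepFamily (q : ℂ) (n : ℕ) (Φ : ∀ m, Hecke q m →ₐ[ℂ] TMat A n m) : Prop :=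
  ∀ m k, k < m - 1 → Φ m (Tn q m k) = RcLeg A q n m k

namespace IsRepFamily

variable {q : ℂ} {n : ℕ} {Φ : ∀ m, Hecke q m →ₐ[ℂ] TMat A n m}

theorem emb_apply (hΦ : IsRepFamily q n Φ) (hq : q ≠ 0) (m : ℕ) (x : Hecke q m) :
    emb A n m (Φ m x) = Φ (m + 1) (incl hq m x) := by
  induction x using hecke_induction with
  | algebraMap c => simp only [AlgHom.commutes]
  | gen k hk =>
    rw [hΦ m k hk, incl_Tn hq hk, hΦ (m + 1) k (by omega), RcLeg, RcLeg,
      emb_leg2 n m _ (by omega) (by omega)]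
  | mul x y hx hy => simp only [map_mul, hx, hy]
  | add x y hx hy => simp only [map_add, hx, hy]

theorem commute_shift (hΦ : IsRepFamily q n Φ) (hq : q ≠ 0) (m : ℕ) (x : Hecke q m)
    (X : Matrix (Fin n) (Fin n) A) :
    Commute (Φ (m + 1) (shift hq m x)) (leg1 n (m + 1) X 0) := by
  induction x using hecke_induction with
  | algebraMap c =>
    simp only [AlgHom.commutes]
    exact Algebra.commutes c _
  | gen k hk =>
    rw [shift_Tn hq hk, hΦ (m + 1) (k + 1) (by omega)]
    exact commute_RcLeg_leg1 q (by omega) (by omega) X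
  | mul x y hx hy =>
    rw [map_mul, map_mul]
    exact hx.mul_left hy
  | add x y hx hy =>
    rw [map_add, map_add]
    exact hx.add_left hy

theorem commute_of_RcLeg (hΦ : IsRepFamily q n Φ) {m : ℕ} {Z : TMat A n m}
    (hZ : ∀ k, k < m - 1 → Commute (RcLeg A q n m k) Z) (x : Hecke q m) :
    Commute (Φ m x) Z := by
  induction x using hecke_induction with
  | algebraMap c =>
    rw [AlgHom.commutes]
    exact Algebra.commutes c _
  | gen k hk =>
    rw [hΦ m k hk]
    exact hZ k hk
  | mul x y hx hy =>
    rw [map_mul]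
    exact hx.mul_left hy
  | add x y hx hy =>
    rw [map_add]
    exact hx.add_left hy

theorem qTr_comm (hΦ : IsRepFamily q n Φ) {m : ℕ} (x : Hecke q m) (Y : TMat A n m) :
    qTr q n m (Φ m x * Y) = qTr q n m (Y * Φ m x) := by
  induction x using hecke_induction generalizing Y with
  | algebraMap c => rw [AlgHom.commutes, Algebra.commutes]
  | gen k hk =>
    rw [hΦ m k hk]
    exact qTr_RcLeg_comm q (by omega) Y
  | mul x y hx hy => rw [map_mul, mul_assoc, hx, mul_assoc, hy, mul_assoc]
  | add x y hx hy => rw [map_add, add_mul, mul_add, qTr_add, qTr_add, hx, hy]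

theorem isReflection (hΦ : IsRepFamily q n Φ) (hq : q ≠ 0) {m : ℕ}
    {X : Matrix (Fin n) (Fin n) A}
    (hX : 0 < m - 1 → RcLeg A q n m 0 * leg1 n m X 0 * RcLeg A q n m 0 * leg1 n m X 0 =
      leg1 n m X 0 * RcLeg A q n m 0 * leg1 n m X 0 * RcLeg A q n m 0) :
    IsReflection (m - 1) (RcLeg A q n m) (RcLegInv A q n m) (leg1 n m X 0) where
  mul_inv k hk := by
    rw [RcLegInv_eq A hq (by omega), ← hΦ m k hk, ← map_one (Φ m), ← map_smul, ← map_sub,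
      ← map_mul, Tn_mul_inv hq hk]
  inv_mul k hk := by
    rw [RcLegInv_eq A hq (by omega), ← hΦ m k hk, ← map_one (Φ m), ← map_smul, ← map_sub,
      ← map_mul, Tn_inv_mul hq hk]
  braid k hk := by
    rw [← hΦ m k (by omega), ← hΦ m (k + 1) hk, ← map_mul, ← map_mul, ← map_mul, ← map_mul,
      Tn_braid q hk]
  comm j k h hk := by
    rw [← hΦ m j (by omega), ← hΦ m k hk]
    exact (Tn_comm q m h).map (Φ m)
  comm_l k hk h0 := commute_RcLeg_leg1 q (by omega) h0 X
  refl := hX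

end IsRepFamily

theorem legBar_eq_bar (q : ℂ) (n m : ℕ) (X : Matrix (Fin n) (Fin n) A) (k : ℕ) :
    legBar q n m X k = bar (RcLeg A q n m) (RcLegInv A q n m) (leg1 n m X 0) k := by
  induction k with
  | zero => rfl
  | succ k ih => rw [legBar, bar, ih]

theorem emb_legBar (q : ℂ) (n m : ℕ) (X : Matrix (Fin n) (Fin n) A) {k : ℕ} (hk : k < m) :
    emb A n m (legBar q n m X k) = legBar q n (m + 1) X k := by
  induction k with
  | zero => exact emb_leg1 n m X hk
  | succ k ih =>
    rw [legBar, legBar, map_mul, map_mul, ih (by omega), RcLeg, RcLeg, RcLegInv, RcLegInv,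
      emb_leg2 n m _ (by omega) hk, emb_leg2 n m _ (by omega) hk]

/-- `L_{1̄} ⋯ L_{r̄}` on `m` tensor factors. -/
def barProd (q : ℂ) (n m : ℕ) (X : Matrix (Fin n) (Fin n) A) (r : ℕ) : TMat A n m :=
  ((List.range r).map (legBar q n m X)).prod

theorem emb_barProd (q : ℂ) (n m : ℕ) (X : Matrix (Fin n) (Fin n) A) {r : ℕ} (hr : r ≤ m) :
    emb A n m (barProd q n m X r) = barProd q n (m + 1) X r := by
  induction r with
  | zero => simp [barProd]
  | succ r ih =>
    have := ih (by omega)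
    simp only [barProd] at this ⊢
    rw [List.range_succ, List.map_append, List.prod_append, map_mul, this, List.map_append,
      List.prod_append]
    simp [emb_legBar q n m X (show r < m by omega)]

theorem qTr_leg1_pow_mul_emb (q : ℂ) (n k : ℕ) (X : Matrix (Fin n) (Fin n) A) (Y : TMat A n 0) :
    qTr q n 1 (leg1 n 1 X 0 ^ k * emb A n 0 Y) = qTr1 q n (X ^ k) * qTr q n 0 Y := by
  have h1 : ∀ (X : Matrix (Fin n) (Fin n) A) (i j : Fin 0 → Fin n) (x y : Fin n),
      leg1 n 1 X 0 (sn i x) (sn j y) = X x y := by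
    intro X i j x y
    rw [leg1, dif_pos Nat.one_pos, if_pos fun c hc => absurd (by omega) hc]
    exact congrArg₂ X (sn_last i x) (sn_last j y)
  have h2 : leg1 n 1 X 0 ^ k = leg1 n 1 (X ^ k) 0 := by
    induction k with
    | zero =>
      refine ext_sn fun i j x y => ?_
      rw [h1, pow_zero, pow_zero, Matrix.one_apply, Matrix.one_apply]
      obtain rfl : i = j := Subsingleton.elim i j
      simp [sn_inj]
    | succ k ih =>
      refine ext_sn fun i j x y => ?_
      rw [h1, pow_succ, pow_succ, ih, Matrix.mul_apply, Matrix.mul_apply, sum_sn]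
      simp [h1]
  rw [qTr_ptr, ptr_mul_emb, h2]
  simp [qTr, qTr1, ptr, Matrix.mul_apply, h1, dw, Algebra.smul_def]

/-! ### The Newton identity for matrices satisfying the reflection equation -/

theorem ptr_smul_one_mul (q : ℂ) {n m : ℕ} (hq : q ≠ 0) (Y Z : TMat A n (m + 1)) :
    ptr q (emb A n (m + 1) Y * RcLeg A q n (m + 2) m * emb A n (m + 1) Z) = q • (Y * Z) := by
  rw [ptr_mul_emb, ptr_emb_mul, ptr_RcLeg_last hq]
  simp

namespace IsRepFamily

variable {q : ℂ} {n : ℕ} {Φ : ∀ m, Hecke q m →ₐ[ℂ] TMat A n m}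

theorem qTr_asc_emb (hΦ : IsRepFamily q n Φ) (hq : q ≠ 0) (X : Matrix (Fin n) (Fin n) A)
    (k r : ℕ) (Y : TMat A n r) :
    qTr q n (r + 1) (leg1 n (r + 1) X 0 ^ k * Φ (r + 1) (Tasc q (r + 1) r) * emb A n r Y *
      Φ (r + 1) (TascInv q (r + 1) r)) = qTr1 q n (X ^ k) * qTr q n r Y := by
  induction r with
  | zero => simpa [Tasc, TascInv] using qTr_leg1_pow_mul_emb q n k X Y
  | succ r ih =>
    rw [qTr_ptr q Y, ← ih, qTr_ptr]
    congr 1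
    have h1 : Φ (r + 2) (Tasc q (r + 2) (r + 1)) =
        emb A n (r + 1) (Φ (r + 1) (Tasc q (r + 1) r)) * RcLeg A q n (r + 2) r := by
      rw [hΦ.emb_apply hq, incl_Tasc hq (by omega), Tasc, map_mul, hΦ (r + 2) r (by omega)]
    have h2 : Φ (r + 2) (TascInv q (r + 2) (r + 1)) =
        RcLegInv A q n (r + 2) r * emb A n (r + 1) (Φ (r + 1) (TascInv q (r + 1) r)) := by
      rw [hΦ.emb_apply hq, incl_TascInv hq (by omega), TascInv, map_mul, map_sub, map_smul,
        map_one, hΦ (r + 2) r (by omega), RcLegInv_eq A hq (by omega)]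
    have h3 : leg1 n (r + 2) X 0 ^ k = emb A n (r + 1) (leg1 n (r + 1) X 0 ^ k) := by
      rw [map_pow, emb_leg1 n (r + 1) X (by omega)]
    rw [h1, h2, h3, ← ptr_RcLeg_conj hq, ← ptr_emb_mul, ← ptr_mul_emb, map_mul]
    simp only [mul_assoc]

/-- `tr_q L₁^k L_{1̄} ⋯ L_{r̄} E_r`. -/
def powElem (q : ℂ) (n : ℕ) (Φ : ∀ m, Hecke q m →ₐ[ℂ] TMat A n m) (e : ∀ m, Hecke q m)
    (X : Matrix (Fin n) (Fin n) A) (k r : ℕ) : A :=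
  qTr q n r (leg1 n r X 0 ^ k * barProd q n r X r * Φ r (e r))

/-- `X` satisfies the reflection equation in all tensor powers. -/
def IsReflMatrix (q : ℂ) (n : ℕ) (X : Matrix (Fin n) (Fin n) A) : Prop :=
  ∀ m, IsReflection (m - 1) (RcLeg A q n m) (RcLegInv A q n m) (leg1 n m X 0)

theorem leg1_mul_asc_mul_barProd (hΦ : IsRepFamily q n Φ) {X : Matrix (Fin n) (Fin n) A}
    (hX : IsReflMatrix q n X) (r : ℕ) :
    leg1 n (r + 1) X 0 * (Φ (r + 1) (Tasc q (r + 1) r) * barProd q n (r + 1) X r) =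
      barProd q n (r + 1) X (r + 1) * Φ (r + 1) (Tasc q (r + 1) r) := by
  have h := (hX (r + 1)).mul_asc_mul_prod_bar (r := r) (by omega)
  have h1 : ∀ j ≤ r, Φ (r + 1) (Tasc q (r + 1) j) =
      IsReflection.asc (RcLeg A q n (r + 1)) j := by
    intro j hj
    induction j with
    | zero => simp [Tasc, IsReflection.asc]
    | succ j ih => rw [Tasc, map_mul, ih (by omega), hΦ (r + 1) j (by omega), IsReflection.asc]
  have h2 : legBar q n (r + 1) X =
      bar (RcLeg A q n (r + 1)) (RcLegInv A q n (r + 1)) (leg1 n (r + 1) X 0) :=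
    funext fun k => legBar_eq_bar q n (r + 1) X k
  rw [h1 r le_rfl, barProd, barProd, h2, h]

theorem commute_barProd (hΦ : IsRepFamily q n Φ) {X : Matrix (Fin n) (Fin n) A}
    (hX : IsReflMatrix q n X) (m : ℕ) (x : Hecke q m) :
    Commute (Φ m x) (barProd q n m X m) := by
  refine hΦ.commute_of_RcLeg (fun k hk => ?_) x
  have h2 : legBar q n m X = bar (RcLeg A q n m) (RcLegInv A q n m) (leg1 n m X 0) :=
    funext fun k => legBar_eq_bar q n m X k
  rw [barProd, h2]
  exact (hX m).commute_prod_bar (by omega) (by omega)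

theorem qTr_asc_gen (hΦ : IsRepFamily q n Φ) (hq : q ≠ 0) (X : Matrix (Fin n) (Fin n) A)
    (k m : ℕ) (Y : TMat A n (m + 1)) :
    qTr q n (m + 2) (leg1 n (m + 2) X 0 ^ k * Φ (m + 2) (Tasc q (m + 2) (m + 1)) *
      emb A n (m + 1) Y * Φ (m + 2) (TascInv q (m + 2) (m + 1) * Tn q (m + 2) 0)) =
      q • qTr q n (m + 1) (leg1 n (m + 1) X 0 ^ k * Y) := by
  set S := shift hq (m + 1) (TascInv q (m + 1) m) with hS
  have h1 : TascInv q (m + 2) (m + 1) * Tn q (m + 2) 0 = S := by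
    calc TascInv q (m + 2) (m + 1) * Tn q (m + 2) 0
        = TascInv q (m + 2) (m + 1) *
            (Tn q (m + 2) 0 * shift hq (m + 1) (Tasc q (m + 1) m)) * S := by
          rw [mul_assoc, mul_assoc, hS, ← map_mul, Tasc_mul_inv hq (by omega), map_one, mul_one]
      _ = S := by
          rw [Tn_mul_shift_Tasc hq (by omega), TascInv_mul hq (by omega), one_mul]
  have h2 : Φ (m + 2) (S * Tasc q (m + 2) (m + 1)) =
      emb A n (m + 1) (Φ (m + 1) (Tasc q (m + 1) m)) * RcLeg A q n (m + 2) m *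
        emb A n (m + 1) (Φ (m + 1) (TascInv q (m + 1) m)) := by
    rw [hS, ← Tasc_mul_incl, hΦ.emb_apply hq, hΦ.emb_apply hq, incl_Tasc hq (by omega), Tasc,
      map_mul, map_mul, hΦ (m + 2) m (by omega)]
  have h3 : leg1 n (m + 2) X 0 ^ k = emb A n (m + 1) (leg1 n (m + 1) X 0 ^ k) := by
    rw [map_pow, emb_leg1 n (m + 1) X (by omega)]
  have h4 := (hΦ.commute_shift hq (m + 1) (TascInv q (m + 1) m) X).pow_right k
  rw [← hS] at h4
  rw [h1, ← hΦ.qTr_comm, ← mul_assoc, ← mul_assoc, h4.eq, mul_assoc _ (Φ (m + 2) S), ← map_mul,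
    h2, h3, qTr_ptr, ← qTr_smul]
  congr 1
  have h5 := ptr_smul_one_mul q hq (leg1 n (m + 1) X 0 ^ k * Φ (m + 1) (Tasc q (m + 1) m))
    (Φ (m + 1) (TascInv q (m + 1) m) * Y)
  rw [mul_assoc _ _ (_ * Y), ← mul_assoc (Φ _ _) (Φ _ _) Y, ← map_mul (Φ (m + 1)),
    Tasc_mul_inv hq (by omega), map_one, one_mul] at h5
  rw [← h5]
  simp only [map_mul, mul_assoc]

theorem qTr1_pow_mul_powElem (hΦ : IsRepFamily q n Φ) (hq : q ≠ 0) {X : Matrix (Fin n) (Fin n) A}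
    (hX : IsReflMatrix q n X) {e : ∀ m, Hecke q m} (he : ∀ m, IsSignIdem (e m)) (k r : ℕ) :
    qTr1 q n (X ^ (k + 1)) * powElem q n Φ e X 0 r =
      qNum q (r + 1) • powElem q n Φ e X k (r + 1) + qNum q r • powElem q n Φ e X (k + 1) r := by
  set U := Tasc q (r + 1) r with hU
  set V := TascInv q (r + 1) r with hV
  set B := shift hq r (e r) with hB
  set ℓ := leg1 n (r + 1) X 0 with hl
  set Λ := barProd q n (r + 1) X (r + 1) with hΛ
  have hBB : B * B = B := by rw [hB, ← map_mul, (he r).idem]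
  have hUV : U * V = 1 := Tasc_mul_inv hq (by omega)
  have hBU : B = U * incl hq r (e r) * V := by
    rw [hU, Tasc_mul_incl hq, ← hU, mul_assoc, hUV, mul_one]
  have hℓB : Commute (Φ (r + 1) B) ℓ := hΦ.commute_shift hq r (e r) X
  have hΛB : Commute (Φ (r + 1) B) Λ := hΦ.commute_barProd hX (r + 1) B
  have hW : ∀ x : Hecke q (r + 1), ℓ ^ (k + 1) * Φ (r + 1) U *
      emb A n r (barProd q n r X r * Φ r (e r)) * Φ (r + 1) (V * x) =
        ℓ ^ k * Λ * Φ (r + 1) (B * x) := by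
    intro x
    have h1 := hΦ.leg1_mul_asc_mul_barProd hX r
    rw [hBU, map_mul, emb_barProd q n r X le_rfl, hΦ.emb_apply hq, pow_succ]
    simp only [map_mul, mul_assoc]
    rw [← mul_assoc (Φ (r + 1) U) (barProd q n (r + 1) X r), ← mul_assoc ℓ, h1]
    simp only [mul_assoc, hΛ, hU]
  have hL : qTr1 q n (X ^ (k + 1)) * powElem q n Φ e X 0 r =
      qTr q n (r + 1) (ℓ ^ k * Λ * Φ (r + 1) B) := by
    rw [powElem, pow_zero, one_mul, ← hΦ.qTr_asc_emb hq, ← hU, ← hV, ← hl]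
    have := hW 1
    rw [mul_one, mul_one] at this
    rw [this]
  have hM : qNum q r • qTr q n (r + 1) (ℓ ^ k * Λ * Φ (r + 1) (B * Tn q (r + 1) 0 * B)) =
      (qNum q r * q) • powElem q n Φ e X (k + 1) r := by
    rcases r with _ | m
    · simp [qNum]
    · rw [mul_smul]
      congr 1
      have h1 : qTr q n (m + 1 + 1) (ℓ ^ k * Λ * Φ (m + 1 + 1) (B * Tn q (m + 1 + 1) 0 * B)) =
          qTr q n (m + 1 + 1) (ℓ ^ k * Λ * Φ (m + 1 + 1) (B * Tn q (m + 1 + 1) 0)) := by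
        rw [map_mul _ _ B, ← mul_assoc, ← hΦ.qTr_comm, ← mul_assoc,
          ((hℓB.pow_right k).mul_right hΛB).eq, mul_assoc _ (Φ _ B), ← map_mul, ← mul_assoc B,
          hBB]
      rw [h1, ← hW, hΦ.qTr_asc_gen hq, powElem, mul_assoc]
  rw [hL]
  have hrec := IsSignIdem.recursion hq (he (r + 1)) (he r)
  rw [← hB] at hrec
  conv_lhs => rw [← hrec]
  rw [map_add, map_smul, map_smul, mul_add, mul_smul_comm, mul_smul_comm, qTr_add, qTr_smul,
    qTr_smul, mul_smul, hM, smul_smul, mul_comm _ q, ← mul_assoc, inv_mul_cancel₀ hq, one_mul]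
  rfl

theorem newton_coeff (hΦ : IsRepFamily q n Φ) (hq : q ≠ 0) {X : Matrix (Fin n) (Fin n) A}
    (hX : IsReflMatrix q n X) {e : ∀ m, Hecke q m} (he : ∀ m, IsSignIdem (e m)) (m : ℕ) :
    ∑ k ∈ Finset.range m, (-1 : ℂ) ^ (m - (k + 1)) •
        (qTr1 q n (X ^ (k + 1)) * powElem q n Φ e X 0 (m - (k + 1))) =
      -((-1 : ℂ) ^ m * qNum q m) • powElem q n Φ e X 0 m := by
  set g : ℕ → A := fun k => ((-1 : ℂ) ^ (m - k) * qNum q (m - k)) • powElem q n Φ e X k (m - k)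
    with hg
  have h : ∀ k ∈ Finset.range m, (-1 : ℂ) ^ (m - (k + 1)) •
        (qTr1 q n (X ^ (k + 1)) * powElem q n Φ e X 0 (m - (k + 1))) = g (k + 1) - g k := by
    intro k hk
    obtain ⟨r, rfl⟩ : ∃ r, m = k + 1 + r := ⟨m - (k + 1), by have := Finset.mem_range.1 hk; omega⟩
    have h1 : k + 1 + r - k = r + 1 := by omega
    simp only [hg, Nat.add_sub_cancel_left, h1, pow_succ (-1 : ℂ), hΦ.qTr1_pow_mul_powElem hq hX he]
    module
  rw [Finset.sum_congr rfl h, Finset.sum_range_sub]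
  simp [hg, qNum]

end IsRepFamily

end Legs

/-! ### The reflection equation in `U_q(gl_n)` -/

section Flip

variable {F : Type} [Ring F] {n : ℕ}

theorem M1_mul (X Y : Matrix (Fin n) (Fin n) F) : M1 (X * Y) = M1 X * M1 Y := by
  ext ⟨a, b⟩ ⟨c, d⟩
  simp only [M1, Matrix.mul_apply, Fintype.sum_prod_type, ite_mul, zero_mul, Finset.sum_ite_eq,
    Finset.mem_univ, if_true]
  by_cases h : b = d <;> simp [h]

theorem M2_mul (X Y : Matrix (Fin n) (Fin n) F) : M2 (X * Y) = M2 X * M2 Y := by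
  ext ⟨a, b⟩ ⟨c, d⟩
  simp only [M2, Matrix.mul_apply, Fintype.sum_prod_type_right, ite_mul, zero_mul,
    Finset.sum_ite_eq, Finset.mem_univ, if_true]
  by_cases h : a = c <;> simp [h]

theorem M1_one : M1 (1 : Matrix (Fin n) (Fin n) F) = 1 := by
  ext ⟨a, b⟩ ⟨c, d⟩
  by_cases h : b = d <;> by_cases h' : a = c <;> simp [M1, Matrix.one_apply, h, h']

theorem M2_one : M2 (1 : Matrix (Fin n) (Fin n) F) = 1 := by
  ext ⟨a, b⟩ ⟨c, d⟩
  by_cases h : b = d <;> by_cases h' : a = c <;> simp [M2, Matrix.one_apply, h, h']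

variable [Algebra ℂ F]

theorem Pmat_mul_apply (Z : Matrix (Fin n × Fin n) (Fin n × Fin n) F) (p r : Fin n × Fin n) :
    ((Pmat n).map (algebraMap ℂ F) * Z) p r = Z p.swap r := by
  rw [Matrix.mul_apply, Finset.sum_eq_single p.swap]
  · simp [Pmat]
  · rintro s _ hs
    rw [Matrix.map_apply, Pmat, if_neg, map_zero, zero_mul]
    rintro ⟨h1, h2⟩
    exact hs (Prod.ext h2.symm h1.symm)
  · simp

theorem mul_Pmat_apply (Z : Matrix (Fin n × Fin n) (Fin n × Fin n) F) (p r : Fin n × Fin n) :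
    (Z * (Pmat n).map (algebraMap ℂ F)) p r = Z p r.swap := by
  rw [Matrix.mul_apply, Finset.sum_eq_single r.swap]
  · simp [Pmat]
  · rintro s _ hs
    rw [Matrix.map_apply, Pmat, if_neg, map_zero, mul_zero]
    rintro ⟨h1, h2⟩
    exact hs (Prod.ext h1 h2)
  · simp

theorem Pmat_mul_M1 (X : Fin n → Fin n → F) :
    (Pmat n).map (algebraMap ℂ F) * M1 X = M2 X * (Pmat n).map (algebraMap ℂ F) := by
  ext p r
  rw [Pmat_mul_apply, mul_Pmat_apply]
  rfl

theorem Pmat_mul_M2 (X : Fin n → Fin n → F) :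
    (Pmat n).map (algebraMap ℂ F) * M2 X = M1 X * (Pmat n).map (algebraMap ℂ F) := by
  ext p r
  rw [Pmat_mul_apply, mul_Pmat_apply]
  rfl

theorem Rcheck_map (q : ℂ) : (Rcheck q n).map (algebraMap ℂ F) =
    (Pmat n).map (algebraMap ℂ F) * (Rmat q n).map (algebraMap ℂ F) := by
  rw [Rcheck, Matrix.map_mul]

/-- The relation `R X₁ Y₂ = Y₂ X₁ R` in terms of `Ř`. -/
theorem Rcheck_mul_M1_mul_M2 {q : ℂ} {X Y : Fin n → Fin n → F}
    (h : (Rmat q n).map (algebraMap ℂ F) * M1 X * M2 Y =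
      M2 Y * M1 X * (Rmat q n).map (algebraMap ℂ F)) :
    (Rcheck q n).map (algebraMap ℂ F) * M1 X * M2 Y =
      M1 Y * M2 X * (Rcheck q n).map (algebraMap ℂ F) := by
  rw [Rcheck_map, mul_assoc, mul_assoc, ← mul_assoc _ (M1 X), h, ← mul_assoc, ← mul_assoc,
    Pmat_mul_M2, mul_assoc (M1 Y), Pmat_mul_M1]
  simp only [mul_assoc]

end Flip

theorem reflection_of_exchange {M : Type*} [Ring M] {r a₁ a₂ b₁ b₂ k₁ k₂ : M}
    (haa : r * a₁ * a₂ = a₁ * a₂ * r) (hbb : r * b₁ * b₂ = b₁ * b₂ * r)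
    (hab : r * a₁ * b₂ = b₁ * a₂ * r) (h₁ : b₁ * k₁ = 1) (h₁' : k₁ * b₁ = 1) (h₂ : b₂ * k₂ = 1)
    (h₂' : k₂ * b₂ = 1) :
    r * (a₁ * k₁) * r * (a₁ * k₁) = a₁ * k₁ * r * (a₁ * k₁) * r := by
  have h3 : k₁ * r * a₁ = a₂ * r * k₂ := by
    calc k₁ * r * a₁ = k₁ * (r * a₁ * b₂) * k₂ := by
          simp only [mul_assoc]; rw [h₂, mul_one]
      _ = a₂ * r * k₂ := by rw [hab]; simp only [← mul_assoc]; rw [h₁', one_mul]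
  have h4 : k₂ * k₁ * r = r * (k₂ * k₁) := by
    calc k₂ * k₁ * r = k₂ * k₁ * (r * b₁ * b₂) * (k₂ * k₁) := by
          simp only [mul_assoc]; rw [← mul_assoc b₂, h₂, one_mul, h₁, mul_one]
      _ = r * (k₂ * k₁) := by
          rw [hbb]; simp only [← mul_assoc]; rw [mul_assoc k₂ k₁, h₁', mul_one, h₂', one_mul]
  calc r * (a₁ * k₁) * r * (a₁ * k₁) = r * a₁ * (k₁ * r * a₁) * k₁ := by simp only [mul_assoc]
    _ = a₁ * a₂ * r * (r * (k₂ * k₁)) := by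
        rw [h3, ← haa]; simp only [mul_assoc]
    _ = a₁ * (k₁ * r * a₁) * k₁ * r := by rw [← h4, h3]; simp only [mul_assoc]
    _ = _ := by simp only [mul_assoc]

theorem map_M1 {F G : Type} [Ring F] [Ring G] {n : ℕ} (f : F →+* G) (X : Fin n → Fin n → F) :
    (M1 X).map f = M1 fun i j => f (X i j) := by
  ext p r
  simp only [M1, Matrix.map_apply]
  split_ifs <;> simp

theorem map_M2 {F G : Type} [Ring F] [Ring G] {n : ℕ} (f : F →+* G) (X : Fin n → Fin n → F) :
    (M2 X).map f = M2 fun i j => f (X i j) := by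
  ext p r
  simp only [M2, Matrix.map_apply]
  split_ifs <;> simp

theorem rll_of_UqRel {q : ℂ} {n : ℕ} {X Y : Fin n → Fin n → FreeAlgebra ℂ (UqGen n)}
    (h : ∀ x y, UqRel q n ((RmatU q n * M1 X * M2 Y) x y) ((M2 Y * M1 X * RmatU q n) x y)) :
    (Rmat q n).map (algebraMap ℂ (Uq q n)) *
        M1 (fun i j => RingQuot.mkAlgHom ℂ (UqRel q n) (X i j)) *
        M2 (fun i j => RingQuot.mkAlgHom ℂ (UqRel q n) (Y i j)) =
      M2 (fun i j => RingQuot.mkAlgHom ℂ (UqRel q n) (Y i j)) *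
        M1 (fun i j => RingQuot.mkAlgHom ℂ (UqRel q n) (X i j)) *
        (Rmat q n).map (algebraMap ℂ (Uq q n)) := by
  set f : FreeAlgebra ℂ (UqGen n) →+* Uq q n := (RingQuot.mkAlgHom ℂ (UqRel q n)).toRingHom
  have h1 : (RmatU q n * M1 X * M2 Y).map f = (M2 Y * M1 X * RmatU q n).map f := by
    ext x y
    exact RingQuot.mkAlgHom_rel ℂ (h x y)
  have h2 : (RmatU q n).map f = (Rmat q n).map (algebraMap ℂ (Uq q n)) := by
    ext x y
    exact (RingQuot.mkAlgHom ℂ (UqRel q n)).commutes _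
  simp only [Matrix.map_mul, map_M1, map_M2, h2] at h1
  exact h1

theorem reflection_Uq {q : ℂ} {n : ℕ} {K : Matrix (Fin n) (Fin n) (Uq q n)}
    (hK1 : Lm q n * K = 1) (hK2 : K * Lm q n = 1) :
    (Rcheck q n).map (algebraMap ℂ (Uq q n)) * M1 (Lmat q n K) *
        (Rcheck q n).map (algebraMap ℂ (Uq q n)) * M1 (Lmat q n K) =
      M1 (Lmat q n K) * (Rcheck q n).map (algebraMap ℂ (Uq q n)) * M1 (Lmat q n K) *
        (Rcheck q n).map (algebraMap ℂ (Uq q n)) := by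
  rw [Lmat, M1_mul]
  refine reflection_of_exchange (a₂ := M2 (Lp q n)) (b₁ := M1 (Lm q n)) (b₂ := M2 (Lm q n))
    (k₂ := M2 K) (Rcheck_mul_M1_mul_M2 (rll_of_UqRel UqRel.rllPP))
    (Rcheck_mul_M1_mul_M2 (rll_of_UqRel UqRel.rllMM))
    (Rcheck_mul_M1_mul_M2 (rll_of_UqRel UqRel.rllPM)) ?_ ?_ ?_ ?_
  · rw [← M1_mul, hK1, M1_one]
  · rw [← M1_mul, hK2, M1_one]
  · rw [← M2_mul, hK1, M2_one]
  · rw [← M2_mul, hK2, M2_one]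

theorem RcLeg_two (A : Type) [Ring A] [Algebra ℂ A] (q : ℂ) (n : ℕ) :
    RcLeg A q n 2 0 = ((Rcheck q n).map (algebraMap ℂ A)).submatrix
      (finTwoArrowEquiv (Fin n)) (finTwoArrowEquiv (Fin n)) := by
  ext i j
  rw [RcLeg, leg2, dif_pos ⟨by omega, by omega⟩, if_pos fun c h0 h1 => absurd c.2 (by omega)]
  rfl

theorem leg1_two {A : Type} [Ring A] {n : ℕ} (X : Matrix (Fin n) (Fin n) A) :
    leg1 n 2 X 0 = (M1 X).submatrix (finTwoArrowEquiv (Fin n)) (finTwoArrowEquiv (Fin n)) := by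
  ext i j
  rw [leg1, dif_pos (by omega)]
  refine if_congr ⟨fun h => h 1 (by simp), fun h c hc => ?_⟩ rfl rfl
  obtain rfl : c = 1 := Fin.ext (by simp; omega)
  exact h

theorem reflection_legs {A : Type} [Ring A] [Algebra ℂ A] {q : ℂ} {n : ℕ}
    {X : Matrix (Fin n) (Fin n) A}
    (h : (Rcheck q n).map (algebraMap ℂ A) * M1 X * (Rcheck q n).map (algebraMap ℂ A) * M1 X =
      M1 X * (Rcheck q n).map (algebraMap ℂ A) * M1 X * (Rcheck q n).map (algebraMap ℂ A))
    (m : ℕ) :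
    RcLeg A q n (m + 2) 0 * leg1 n (m + 2) X 0 * RcLeg A q n (m + 2) 0 * leg1 n (m + 2) X 0 =
      leg1 n (m + 2) X 0 * RcLeg A q n (m + 2) 0 * leg1 n (m + 2) X 0 * RcLeg A q n (m + 2) 0 := by
  induction m with
  | zero =>
    rw [zero_add, RcLeg_two, leg1_two]
    simp only [Matrix.submatrix_mul_equiv, h]
  | succ m ih =>
    have := congrArg (emb A n (m + 2)) ih
    simpa only [map_mul, RcLeg, emb_leg2 n (m + 2) _ (show 0 < m + 2 by omega)
      (show 0 + 1 < m + 2 by omega), emb_leg1 n (m + 2) X (show 0 < m + 2 by omega)] using this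

/-! ### Vanishing of the antisymmetrizers -/

theorem apply_eq_zero_of_eq {q : ℂ} (hq : q + q⁻¹ ≠ 0) (hq0 : q ≠ 0) {n m : ℕ}
    {E : Matrix (Fin m → Fin n) (Fin m → Fin n) ℂ}
    (hE : ∀ k, k + 1 < m → RcLeg ℂ q n m k * E = (-q⁻¹) • E) (d : ℕ) :
    ∀ (a : ℕ) (h : a + d + 1 < m) (i j : Fin m → Fin n),
      i ⟨a, by omega⟩ = i ⟨a + d + 1, h⟩ → E i j = 0 := by
  have row : ∀ k (hk : k + 1 < m) (i j : Fin m → Fin n),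
      rA q (i ⟨k, by omega⟩) (i ⟨k + 1, hk⟩) * E (swp k hk i) j +
        rB q (i ⟨k, by omega⟩) (i ⟨k + 1, hk⟩) * E i j = -q⁻¹ * E i j := by
    intro k hk i j
    have := congrFun (congrFun (hE k hk) i) j
    rwa [RcLeg_mul_apply q hk] at this
  induction d with
  | zero =>
    intro a h i j hi
    have h1 := row a h i j
    have h2 : swp a h i = i := by
      ext c
      rw [swp, Function.comp_apply]
      by_cases hc : c = ⟨a, by omega⟩
      · rw [hc, Equiv.swap_apply_left]
        exact congrArg Fin.val hi.symm
      · by_cases hc' : c = ⟨a + 1, h⟩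
        · rw [hc', Equiv.swap_apply_right]
          exact congrArg Fin.val hi
        · rw [Equiv.swap_apply_of_ne_of_ne hc hc']
    have hi' : i ⟨a, by omega⟩ = i ⟨a + 1, h⟩ := hi
    rw [h2, ← hi', rA, if_pos rfl, rB, if_neg (lt_irrefl _)] at h1
    have h3 : (q + q⁻¹) * E i j = 0 := by linear_combination h1
    exact (mul_eq_zero.1 h3).resolve_left hq
  | succ d ih =>
    intro a h i j hi
    have hk : a + d + 1 + 1 < m := h
    have h1 : E (swp (a + d + 1) hk i) j = 0 := by
      refine ih a (by omega) _ _ ?_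
      rw [swp, Function.comp_apply, Function.comp_apply, Equiv.swap_apply_left,
        Equiv.swap_apply_of_ne_of_ne]
      · exact hi
      · simp [Fin.ext_iff]; omega
      · simp [Fin.ext_iff]; omega
    have h2 := row (a + d + 1) hk (swp (a + d + 1) hk i) j
    rw [swp_swp, h1, mul_zero, mul_zero, add_zero] at h2
    refine (mul_eq_zero.1 h2).resolve_left ?_
    rw [rA]
    split_ifs
    · exact hq0
    · exact one_ne_zero

theorem IsSignIdem.map_eq_zero {q : ℂ} (hq : q ≠ 0) (hq' : NotRootOfUnity q) {n m : ℕ}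
    {e : Hecke q m} (he : IsSignIdem e)
    {φ : Hecke q m →ₐ[ℂ] Matrix (Fin m → Fin n) (Fin m → Fin n) ℂ} (hφ : IsHeckeRep q n m φ)
    (hm : n < m) : φ e = 0 := by
  have hqq : q + q⁻¹ ≠ 0 := by
    intro h
    have h1 : q ^ 2 = -1 := by
      have h2 : q * q⁻¹ = 1 := mul_inv_cancel₀ hq
      linear_combination q * h - h2
    exact hq' 4 (by norm_num) (by linear_combination (q ^ 2 - 1) * h1)
  have hE : ∀ k, k + 1 < m → RcLeg ℂ q n m k * φ e = (-q⁻¹) • φ e := fun k hk => by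
    rw [← hφ k (by omega), ← map_mul, he.gen_mul k (by omega), map_smul]
  ext i j
  obtain ⟨a, b, hab, hi⟩ := Fintype.exists_ne_map_eq_of_card_lt i (by simpa using hm)
  wlog hlt : a < b generalizing a b
  · exact this b a hab.symm hi.symm (lt_of_le_of_ne (not_lt.1 hlt) hab.symm)
  have hlt' : (a : ℕ) < b := hlt
  refine apply_eq_zero_of_eq hqq hq hE (b - a - 1) a (by omega) i j ?_
  convert hi using 2
  exact Fin.ext (by simp; omega)

/-! ### The Newton identity -/

theorem map_RcLeg (A : Type) [Ring A] [Algebra ℂ A] (q : ℂ) (n m k : ℕ) :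
    (RcLeg ℂ q n m k).map (algebraMap ℂ A) = RcLeg A q n m k := by
  ext i j
  rw [Matrix.map_apply, RcLeg, RcLeg, leg2, leg2]
  split_ifs <;> simp

theorem one_sub_mul_qNum (q : ℂ) (m : ℕ) :
    (1 - q ^ (-2 : ℤ)) * qNum q m = 1 - q ^ (-2 * (m : ℤ)) := by
  have h : q ^ (-2 : ℤ) = q⁻¹ ^ 2 := by rw [zpow_neg, inv_pow]; rfl
  rw [zpow_mul, h, zpow_natCast, qNum, mul_neg_geom_sum]

/-- The homomorphisms to matrices over `A` induced by homomorphisms to complex matrices. -/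
def repMap (A : Type) [Ring A] [Algebra ℂ A] {q : ℂ} {n : ℕ}
    (φ : ∀ m : ℕ, Hecke q m →ₐ[ℂ] Matrix (Fin m → Fin n) (Fin m → Fin n) ℂ) (m : ℕ) :
    Hecke q m →ₐ[ℂ] TMat A n m :=
  (Algebra.ofId ℂ A).mapMatrix.comp (φ m)

theorem isRepFamily_repMap (A : Type) [Ring A] [Algebra ℂ A] {q : ℂ} {n : ℕ}
    {φ : ∀ m : ℕ, Hecke q m →ₐ[ℂ] Matrix (Fin m → Fin n) (Fin m → Fin n) ℂ}
    (hφ : ∀ m : ℕ, IsHeckeRep q n m (φ m)) : IsRepFamily q n (repMap A φ) := fun m k hk => by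
  rw [← map_RcLeg, ← hφ m k hk]
  rfl

theorem isReflMatrix_Lmat {q : ℂ} (hq : q ≠ 0) {n : ℕ} {Φ : ∀ m, Hecke q m →ₐ[ℂ] TMat (Uq q n) n m}
    (hΦ : IsRepFamily q n Φ) {K : Matrix (Fin n) (Fin n) (Uq q n)}
    (hK1 : Lm q n * K = 1) (hK2 : K * Lm q n = 1) :
    IsRepFamily.IsReflMatrix q n (Lmat q n K) := fun m => hΦ.isReflection hq fun hm => by
  obtain ⟨m, rfl⟩ : ∃ k, m = k + 2 := ⟨m - 2, by omega⟩
  exact reflection_legs (reflection_Uq hK1 hK2) m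

theorem qTr_one_zero {A : Type} [Ring A] [Algebra ℂ A] (q : ℂ) (n : ℕ) :
    qTr q n 0 (1 : TMat A n 0) = 1 := by
  simp [qTr]

/-- the Newton identity
`(1 + (1 − q⁻²) ∑_{m≥1} tr_q(L^m) u^{−m}) · E(u) = E(uq²)` in `U_q(gl_n)`, as formal power
series in `u⁻¹`, where `E(u) = ∑_{m=0}^n (−u)^{−m} tr_{q(1,…,m)} L_{1̄}⋯L_{m̄} E_{(1^m)}`. -/
theorem newton_identity (n : ℕ) (hn : 1 ≤ n) (q : ℂ) (hq : q ≠ 0)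
    (hq' : NotRootOfUnity q)
    (K : Matrix (Fin n) (Fin n) (Uq q n)) (hK1 : Lm q n * K = 1) (hK2 : K * Lm q n = 1)
    (φ : ∀ m : ℕ, Hecke q m →ₐ[ℂ] Matrix (Fin m → Fin n) (Fin m → Fin n) ℂ)
    (hφ : ∀ m : ℕ, IsHeckeRep q n m (φ m))
    (e : ∀ m : ℕ, Hecke q m)
    (he : ∀ m : ℕ, e m ≠ 0 ∧ e m * e m = e m ∧ ∀ k : ℕ, 1 ≤ k → k ≤ m →
      yJM q m k * e m = (q ^ (-2 * ((k : ℤ) - 1)) : ℂ) • e m ∧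
      e m * yJM q m k = (q ^ (-2 * ((k : ℤ) - 1)) : ℂ) • e m) :
    (PowerSeries.mk fun k : ℕ => if k = 0 then 1 else
        algebraMap ℂ (Uq q n) (1 - q ^ (-2 : ℤ)) * qTr1 q n (Lmat q n K ^ k)) *
      (PowerSeries.mk fun k : ℕ => if k = 0 then 1 else if k ≤ n then
        ((-1 : ℂ) ^ k) • colElem q n k K (φ k) (e k) else 0) =
    (PowerSeries.mk fun k : ℕ => if k = 0 then 1 else if k ≤ n then
        ((-1 : ℂ) ^ k * q ^ (-2 * (k : ℤ))) • colElem q n k K (φ k) (e k) else 0) := by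
  have hs : ∀ m, IsSignIdem (e m) := fun m => isSignIdem_of_jucysMurphy hq hq' (e m) (he m)
  have hΦ : IsRepFamily q n (repMap (Uq q n) φ) := isRepFamily_repMap (Uq q n) hφ
  set G : ℕ → Uq q n := IsRepFamily.powElem q n (repMap (Uq q n) φ) e (Lmat q n K) 0 with hG
  have hcol : ∀ k, colElem q n k K (φ k) (e k) = G k := fun k => by
    rw [hG, IsRepFamily.powElem, pow_zero, one_mul]
    rfl
  have hG0 : G 0 = 1 := by
    rw [hG, IsRepFamily.powElem, pow_zero, one_mul, (hs 0).eq_one hq (Nat.zero_le 1), map_one,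
      mul_one]
    exact qTr_one_zero q n
  have hGn : ∀ k, n < k → G k = 0 := fun k hk => by
    rw [← hcol, colElem, (hs k).map_eq_zero hq hq' (hφ k) hk,
      Matrix.map_zero _ (map_zero _), mul_zero]
    simp [qTr]
  have hcoeff : ∀ c : ℕ → ℂ, c 0 = 1 → (fun k : ℕ => if k = 0 then 1 else if k ≤ n then
      c k • colElem q n k K (φ k) (e k) else 0) = fun k => c k • G k := fun c hc => by
    funext k
    split_ifs with h1 h2
    · rw [h1, hc, one_smul, hG0]
    · rw [hcol]
    · rw [hGn k (not_le.1 h2), smul_zero]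
  rw [hcoeff (fun k => (-1) ^ k) (pow_zero _),
    hcoeff (fun k => (-1) ^ k * q ^ (-2 * (k : ℤ))) (by simp)]
  ext m
  rw [PowerSeries.coeff_mul, Finset.Nat.sum_antidiagonal_eq_sum_range_succ_mk,
    Finset.sum_range_succ']
  simp only [PowerSeries.coeff_mk, if_true, if_neg (Nat.succ_ne_zero _), Nat.sub_zero, one_mul]
  have hN := hΦ.newton_coeff hq (isReflMatrix_Lmat hq hΦ hK1 hK2) hs m
  have hsum : ∑ k ∈ Finset.range m, algebraMap ℂ (Uq q n) (1 - q ^ (-2 : ℤ)) *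
        qTr1 q n (Lmat q n K ^ (k + 1)) * ((-1 : ℂ) ^ (m - (k + 1)) • G (m - (k + 1))) =
      (1 - q ^ (-2 : ℤ)) • -((-1 : ℂ) ^ m * qNum q m) • G m := by
    rw [← hN, Finset.smul_sum]
    refine Finset.sum_congr rfl fun k _ => ?_
    rw [mul_assoc, ← Algebra.smul_def, mul_smul_comm]
  rw [hsum, smul_smul, ← add_smul]
  congr 1
  linear_combination -(-1 : ℂ) ^ m * one_sub_mul_qNum q m

end QImm
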